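/- arXiv:1606.09097 — 2 statements merged into one kernel-verified Lean document; each statement's English description precedes it below -/
import Mathlib

section
/- Let n ≥ 3, and let H be a group generated by 2 elements that has a normal subgroup A of finite index with A isomorphic to ℤⁿ. Fix a finite generating set S of H. Then there exists a constant C > 0 such that for every k ≥ 1, the number of distinct subgroups of A of the form N ∩ A, where N ranges over finite-index normal subgroups of H with diam_S(H/N) ≤ k, is at most C·k^{n²−1}. -/
/-- The word length of `h` with respect to the (symmetrized) generating set `S`. -/
noncomputable def wordLength {H : Type*} [Group H] (S : Set H) (h : H) : ℕ :=
  sInf {ℓ : ℕ | ∃ w : List H, (∀ g ∈ w, g ∈ S ∪ S⁻¹) ∧ w.prod = h ∧ w.length = ℓ}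

/-- The diameter of `H/N` in the word metric induced by the generating set `S` of `H`:
the supremum over cosets `hN` of the minimal word length of a representative. -/
noncomputable def quotDiam {H : Type*} [Group H] (S : Set H) (N : Subgroup H) : ℕ :=
  sSup (Set.range fun h : H => sInf {ℓ : ℕ | ∃ n ∈ N, wordLength S (h * n) = ℓ})

section main_aux
open Module

/-- orbit of a list of vectors under the powers of `E` -/
def orb {n : ℕ} (E : End ℝ (Fin n → ℝ)) (vs : List (Fin n → ℝ)) : Set (Fin n → ℝ) :=
  {x | ∃ v ∈ vs, ∃ j : ℕ, x = (E ^ j) v}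

inductive Greedy {n : ℕ} (E : End ℝ (Fin n → ℝ)) (L : AddSubgroup (Fin n → ℝ)) :
    List (Fin n → ℝ) → Prop
  | nil : Greedy E L []
  | cons (v : Fin n → ℝ) (ws : List (Fin n → ℝ)) (hw : Greedy E L ws) (hv : v ∈ L)
      (hU : v ∉ Submodule.span ℝ (orb E ws))
      (hmin : ∀ w ∈ L, w ∉ Submodule.span ℝ (orb E ws) → ‖v‖ ≤ ‖w‖) : Greedy E L (v :: ws)

lemma round_lemma {n : ℕ} (T : Finset (Fin n → ℝ)) (D : ℝ) (hD : ∀ t ∈ T, ‖t‖ ≤ D)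
    (x : Fin n → ℝ) (hx : x ∈ Submodule.span ℝ (T : Set (Fin n → ℝ))) :
    ∃ y, x - y ∈ AddSubgroup.closure (T : Set (Fin n → ℝ)) ∧ ‖y‖ ≤ T.card * D := by
  obtain ⟨f, -, hf⟩ := Submodule.mem_span_finset.1 hx
  refine ⟨∑ t ∈ T, Int.fract (f t) • t, ?_, ?_⟩
  · rw [← hf, ← Finset.sum_sub_distrib]
    refine AddSubgroup.sum_mem _ fun t ht => ?_
    rw [← sub_smul, Int.self_sub_fract, Int.cast_smul_eq_zsmul]
    exact AddSubgroup.zsmul_mem _ (AddSubgroup.subset_closure ht) _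
  · calc _ ≤ ∑ t ∈ T, ‖Int.fract (f t) • t‖ := norm_sum_le _ _
      _ ≤ ∑ t ∈ T, D := by
        refine Finset.sum_le_sum fun t ht => ?_
        rw [norm_smul, Real.norm_of_nonneg (Int.fract_nonneg _)]
        calc _ ≤ 1 * ‖t‖ := by
              gcongr
              exact (Int.fract_lt_one _).le
          _ ≤ D := by rw [one_mul]; exact hD t ht
      _ = _ := by simp

lemma pack (n K : ℕ) : ∃ B : ℕ, ∀ r : ℝ, 0 < r → ∀ y : ℕ → (Fin n → ℝ),
    (∀ i, ‖y i‖ ≤ K * r) → ∃ i j, i < j ∧ j ≤ B ∧ ‖y j - y i‖ < r := by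
  classical
  set P : Finset (Fin n → ℤ) := Fintype.piFinset fun _ => Finset.Icc (-K : ℤ) K with hP
  refine ⟨P.card, fun r hr y hy => ?_⟩
  have key : ∃ i ∈ Finset.range (P.card + 1), ∃ j ∈ Finset.range (P.card + 1), i ≠ j ∧
      (fun l => ⌊y i l / r⌋) = (fun l => ⌊y j l / r⌋) := by
    apply Finset.exists_ne_map_eq_of_card_lt_of_maps_to (t := P)
    · simp
    · intro i _
      simp only [hP, Finset.mem_coe, Fintype.mem_piFinset, Finset.mem_Icc]
      intro l
      have h1 : |y i l| ≤ K * r := by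
        have := norm_le_pi_norm (y i) l
        rw [Real.norm_eq_abs] at this
        exact this.trans (hy i)
      rw [abs_le] at h1
      constructor
      · rw [Int.le_floor, le_div_iff₀ hr]; push_cast; linarith
      · have : y i l / r ≤ K := by rw [div_le_iff₀ hr]; linarith
        have h2 := (Int.floor_le (y i l / r)).trans this
        exact_mod_cast h2
  have close : ∀ i j, (fun l => ⌊y i l / r⌋) = (fun l => ⌊y j l / r⌋) → ‖y j - y i‖ < r := by
    intro i j h
    rw [pi_norm_lt_iff hr]
    intro l
    have h1 := Int.abs_sub_lt_one_of_floor_eq_floor (congrFun h l)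
    rw [← sub_div, abs_div, abs_of_pos hr, div_lt_one hr, abs_sub_comm] at h1
    simpa using h1
  obtain ⟨i, hi, j, hj, hij, h⟩ := key
  rw [Finset.mem_range] at hi hj
  rcases lt_or_gt_of_ne hij with h' | h'
  · exact ⟨i, j, h', by omega, close i j h⟩
  · exact ⟨j, i, h', by omega, close j i h.symm⟩

section
variable {n : ℕ} {E : End ℝ (Fin n → ℝ)} {L : AddSubgroup (Fin n → ℝ)}

lemma orb_mono_cons (v : Fin n → ℝ) (ws : List (Fin n → ℝ)) : orb E ws ⊆ orb E (v :: ws) := by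
  rintro x ⟨w, hw, j, rfl⟩
  exact ⟨w, List.mem_cons_of_mem _ hw, j, rfl⟩

lemma mem_orb {v : Fin n → ℝ} {ws : List (Fin n → ℝ)} (h : v ∈ ws) : v ∈ orb E ws :=
  ⟨v, h, 0, by simp⟩

lemma orb_nil : orb E [] = ∅ := by
  ext x; simp [orb]

lemma span_orb_inv {ws : List (Fin n → ℝ)} {x : Fin n → ℝ}
    (hx : x ∈ Submodule.span ℝ (orb E ws)) : E x ∈ Submodule.span ℝ (orb E ws) := by
  have : Submodule.span ℝ (orb E ws) ≤ (Submodule.span ℝ (orb E ws)).comap E := by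
    rw [Submodule.span_le]
    rintro x ⟨w, hw, j, rfl⟩
    refine Submodule.subset_span ⟨w, hw, j + 1, ?_⟩
    rw [pow_succ']; rfl
  exact this hx

lemma closure_le_of_inv (hL : ∀ x ∈ L, E x ∈ L) {ws : List (Fin n → ℝ)} (h : ∀ w ∈ ws, w ∈ L) :
    AddSubgroup.closure (orb E ws) ≤ L := by
  rw [AddSubgroup.closure_le]
  rintro x ⟨w, hw, j, rfl⟩
  induction j with
  | zero => simpa using h w hw
  | succ j ih => rw [pow_succ']; exact hL _ ih

lemma pow_mod_orb {m : ℕ} (hE : E ^ m = 1) (j : ℕ) : E ^ j = E ^ (j % m) := by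
  conv_lhs => rw [← Nat.mod_add_div j m, pow_add, pow_mul, hE, one_pow, mul_one]

lemma orb_finset {m : ℕ} (hm : 0 < m) (hE : E ^ m = 1) (ws : List (Fin n → ℝ)) :
    ∃ T : Finset (Fin n → ℝ), (T : Set (Fin n → ℝ)) = orb E ws ∧ T.card ≤ ws.length * m := by
  classical
  refine ⟨(ws.toFinset ×ˢ Finset.range m).image (fun p => (E ^ p.2) p.1), ?_, ?_⟩
  · ext x
    simp only [Finset.coe_image, Set.mem_image, Finset.mem_coe, Finset.mem_product,
      List.mem_toFinset, Finset.mem_range, orb, Set.mem_ofPred_eq, Prod.exists]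
    constructor
    · rintro ⟨a, b, ⟨h1, h2⟩, rfl⟩
      exact ⟨a, h1, b, rfl⟩
    · rintro ⟨a, h1, b, rfl⟩
      exact ⟨a, b % m, ⟨h1, Nat.mod_lt _ hm⟩, by rw [← pow_mod_orb hE]⟩
  · refine Finset.card_image_le.trans ?_
    rw [Finset.card_product, Finset.card_range]
    exact Nat.mul_le_mul_right _ (List.toFinset_card_le _)

lemma pow_bound (E : End ℝ (Fin n → ℝ)) {m : ℕ} (hm : 0 < m) (hE : E ^ m = 1) :
    ∃ C : ℕ, ∀ j v, ‖(E ^ j) v‖ ≤ C * ‖v‖ := by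
  obtain ⟨C, hC⟩ := exists_nat_ge
    (∑ j ∈ Finset.range m, ‖LinearMap.toContinuousLinearMap (E ^ j)‖)
  refine ⟨C, fun j v => ?_⟩
  rw [pow_mod_orb hE]
  have h1 : ‖(E ^ (j % m)) v‖ ≤ ‖LinearMap.toContinuousLinearMap (E ^ (j % m))‖ * ‖v‖ :=
    (LinearMap.toContinuousLinearMap (E ^ (j % m))).le_opNorm v
  refine h1.trans ?_
  gcongr
  refine le_trans ?_ hC
  exact Finset.single_le_sum (f := fun j => ‖LinearMap.toContinuousLinearMap (E ^ j)‖)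
    (fun _ _ => norm_nonneg _) (Finset.mem_range.2 (Nat.mod_lt _ hm))

lemma Greedy.mem {vs : List (Fin n → ℝ)} (h : Greedy E L vs) : ∀ w ∈ vs, w ∈ L := by
  induction h with
  | nil => simp
  | cons v ws hw hv hU hmin ih =>
    intro w hw'
    rcases List.mem_cons.1 hw' with rfl | h
    · exact hv
    · exact ih w h

lemma Greedy.norm_le {vs : List (Fin n → ℝ)} (h : Greedy E L vs) :
    ∀ x ∈ L, x ∉ Submodule.span ℝ (orb E vs) → ∀ w ∈ vs, ‖w‖ ≤ ‖x‖ := by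
  induction h with
  | nil => simp
  | cons v ws hw hv hU hmin ih =>
    intro x hx hxU w hw'
    have hx' : x ∉ Submodule.span ℝ (orb E ws) :=
      fun h => hxU (Submodule.span_mono (orb_mono_cons v ws) h)
    rcases List.mem_cons.1 hw' with rfl | h
    · exact hmin x hx hx'
    · exact ih x hx hx' w h

lemma greedy_bound (E : End ℝ (Fin n → ℝ)) {m : ℕ} (hm : 0 < m) (hE : E ^ m = 1) (s : ℕ) :
    ∃ c : ℕ, 0 < c ∧ ∀ L : AddSubgroup (Fin n → ℝ), (∀ x ∈ L, E x ∈ L) →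
      ∀ vs, Greedy E L vs → vs.length = s → ∀ x ∈ L, x ∈ Submodule.span ℝ (orb E vs) →
      c • x ∈ AddSubgroup.closure (orb E vs) := by
  obtain ⟨C, hC⟩ := pow_bound E hm hE
  induction s with
  | zero =>
    refine ⟨1, one_pos, fun L _ vs _ hl x _ hx => ?_⟩
    rw [List.length_eq_zero_iff] at hl
    subst hl
    rw [orb_nil, Submodule.span_empty, Submodule.mem_bot] at hx
    subst hx
    simp
  | succ s ih =>
    obtain ⟨c, hc, ih⟩ := ih
    obtain ⟨B, hB⟩ := pack n ((s + 1) * m * C)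
    refine ⟨c * B.factorial, Nat.mul_pos hc B.factorial_pos, fun L hL vs hvs hl x hx hxU => ?_⟩
    have hmem := hvs.mem
    cases hvs with
    | nil => simp at hl
    | cons v ws hw hv hU hmin =>
    have hl' : ws.length = s := by simpa using hl
    have hvpos : 0 < ‖v‖ := by
      rw [norm_pos_iff]
      rintro rfl
      exact hU (Submodule.zero_mem _)
    obtain ⟨T, hT, hTc⟩ := orb_finset hm hE (v :: ws)
    have hMle : AddSubgroup.closure (orb E (v :: ws)) ≤ L := closure_le_of_inv hL hmem
    have hTD : ∀ t ∈ T, ‖t‖ ≤ C * ‖v‖ := by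
      intro t ht
      have : t ∈ orb E (v :: ws) := by rw [← hT]; exact ht
      obtain ⟨w, hw', j, rfl⟩ := this
      refine (hC j w).trans ?_
      gcongr
      rcases List.mem_cons.1 hw' with rfl | h
      · exact le_rfl
      · exact hw.norm_le v hv hU w h
    have hy : ∀ i : ℕ, ∃ y, i • x - y ∈ AddSubgroup.closure (orb E (v :: ws)) ∧
        ‖y‖ ≤ ((s + 1) * m * C : ℕ) * ‖v‖ := by
      intro i
      obtain ⟨y, h1, h2⟩ := round_lemma T _ hTD (i • x)
        (by rw [hT]; exact Submodule.smul_of_tower_mem _ i hxU)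
      refine ⟨y, by rwa [← hT], h2.trans ?_⟩
      rw [hl] at hTc
      have : (T.card : ℝ) ≤ ((s + 1) * m : ℕ) := by exact_mod_cast hTc
      calc (T.card : ℝ) * (C * ‖v‖) ≤ ((s + 1) * m : ℕ) * (C * ‖v‖) := by gcongr
        _ = _ := by push_cast; ring
    choose y hy1 hy2 using hy
    obtain ⟨i, j, hij, hjB, hlt⟩ := hB ‖v‖ hvpos y hy2
    have hyL : ∀ i, y i ∈ L := fun i => by
      have := L.sub_mem (L.nsmul_mem hx i) (hMle (hy1 i))
      simpa using this
    have hzU : y j - y i ∈ Submodule.span ℝ (orb E ws) := by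
      by_contra h
      exact absurd (hmin _ (L.sub_mem (hyL j) (hyL i)) h) (not_le.2 hlt)
    have h1 := AddSubgroup.closure_mono (orb_mono_cons v ws)
      (ih L hL ws hw hl' _ (L.sub_mem (hyL j) (hyL i)) hzU)
    have h2 := AddSubgroup.nsmul_mem _ (AddSubgroup.sub_mem _ (hy1 j) (hy1 i)) c
    have h3 := AddSubgroup.add_mem _ h1 h2
    obtain ⟨d, rfl⟩ := Nat.exists_eq_add_of_lt hij
    have h4 : c • (y (i + d + 1) - y i) + c • ((i + d + 1) • x - y (i + d + 1) - (i • x - y i))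
        = (c * (d + 1)) • x := by
      module
    rw [h4] at h3
    obtain ⟨q, hq⟩ : (d + 1) ∣ B.factorial := Nat.dvd_factorial (by omega) (by omega)
    have h5 := AddSubgroup.nsmul_mem _ h3 q
    rw [← mul_smul] at h5
    rw [hq]
    convert h5 using 2
    ring

lemma Greedy.length_le {vs : List (Fin n → ℝ)} (h : Greedy E L vs) :
    vs.length ≤ finrank ℝ (Submodule.span ℝ (orb E vs)) := by
  induction h with
  | nil => simp
  | cons v ws hw hv hU hmin ih =>
    have : Submodule.span ℝ (orb E ws) < Submodule.span ℝ (orb E (v :: ws)) := by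
      refine lt_of_le_of_ne (Submodule.span_mono (orb_mono_cons v ws)) fun h => hU ?_
      rw [h]
      exact Submodule.subset_span (mem_orb List.mem_cons_self)
    have := Submodule.finrank_lt_finrank_of_lt this
    simp only [List.length_cons]
    omega

lemma Greedy.flag {m : ℕ} (hm : 0 < m) (hE : E ^ m = 1) {vs : List (Fin n → ℝ)}
    (h : Greedy E L vs) : vs.length < finrank ℝ (Submodule.span ℝ (orb E vs)) ∨
      ∀ x ∈ Submodule.span ℝ (orb E vs), ((E ^ 2 - 1) ^ vs.length : End ℝ (Fin n → ℝ)) x = 0 := by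
  induction h with
  | nil => right; simp [orb_nil]
  | cons v ws hw hv hU hmin ih =>
    have hvU : v ∈ Submodule.span ℝ (orb E (v :: ws)) :=
      Submodule.subset_span (mem_orb List.mem_cons_self)
    have hle := Submodule.span_mono (R := ℝ) (orb_mono_cons (E := E) v ws)
    have hlt : Submodule.span ℝ (orb E ws) < Submodule.span ℝ (orb E (v :: ws)) := by
      refine lt_of_le_of_ne hle fun h => hU ?_
      rw [h]
      exact hvU
    have hf := Submodule.finrank_lt_finrank_of_lt hlt
    simp only [List.length_cons]
    rcases ih with ih | ih
    · left; omega
    by_cases hcase : ws.length + 1 < finrank ℝ (Submodule.span ℝ (orb E (v :: ws)))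
    · left; exact hcase
    right
    have hlen := hw.length_le
    have hlt2 : Submodule.span ℝ (orb E ws) <
        Submodule.span ℝ (orb E ws) ⊔ Submodule.span ℝ {v} := by
      refine lt_of_le_of_ne le_sup_left fun h => hU ?_
      rw [h]
      exact Submodule.mem_sup_right (Submodule.mem_span_singleton_self v)
    have hf2 := Submodule.finrank_lt_finrank_of_lt hlt2
    have heq : Submodule.span ℝ (orb E ws) ⊔ Submodule.span ℝ {v} =
        Submodule.span ℝ (orb E (v :: ws)) := by
      apply Submodule.eq_of_le_of_finrank_le
      · refine sup_le hle ?_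
        rw [Submodule.span_singleton_le_iff_mem]
        exact hvU
      · omega
    have hEv := span_orb_inv hvU
    rw [← heq] at hEv
    obtain ⟨u, hu, w, hw', hsum⟩ := Submodule.mem_sup.1 hEv
    obtain ⟨a, rfl⟩ := Submodule.mem_span_singleton.1 hw'
    have hpow : ∀ j : ℕ, (E ^ j) v - a ^ j • v ∈ Submodule.span ℝ (orb E ws) := by
      intro j
      induction j with
      | zero => simp
      | succ j ihj =>
        have h1 := span_orb_inv ihj
        have h2 := Submodule.add_mem _ h1 (Submodule.smul_mem _ (a ^ j) hu)
        convert h2 using 1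
        rw [pow_succ', Module.End.mul_apply, map_sub, map_smul, ← hsum]
        module
    have ham : a ^ m = 1 := by
      by_contra hne
      have h1 := hpow m
      rw [hE, Module.End.one_apply] at h1
      have h2 : (1 - a ^ m) • v ∈ Submodule.span ℝ (orb E ws) := by
        rw [sub_smul, one_smul]; exact h1
      exact hU ((Submodule.smul_mem_iff _ (sub_ne_zero.2 (Ne.symm hne))).1 h2)
    have ha2 : a ^ 2 = 1 := by
      rcases (pow_eq_one_iff_of_ne_zero hm.ne').1 ham with h | h
      · simp [h]
      · simp [h.1]
    intro x hx
    rw [← heq] at hx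
    obtain ⟨u', hu', w', hw'', rfl⟩ := Submodule.mem_sup.1 hx
    obtain ⟨b, rfl⟩ := Submodule.mem_span_singleton.1 hw''
    rw [pow_succ, Module.End.mul_apply]
    apply ih
    have h2 := hpow 2
    rw [ha2, one_smul] at h2
    have h3 : (E ^ 2 - 1 : End ℝ (Fin n → ℝ)) (u' + b • v) = ((E ^ 2) u' - u') + b • ((E ^ 2) v - v) := by
      simp only [LinearMap.sub_apply, map_add, map_smul, Module.End.one_apply]
      try module
    rw [h3]
    refine Submodule.add_mem _ (Submodule.sub_mem _ ?_ hu') (Submodule.smul_mem _ _ h2)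
    rw [pow_two]
    exact span_orb_inv (span_orb_inv hu')

lemma sq_eq_one_of_nilp {m k : ℕ} (hm : 0 < m) (hE : E ^ m = 1) (h : (E ^ 2 - 1) ^ k = 0) :
    E ^ 2 = 1 := by
  have hss : E.IsSemisimple := by
    apply Module.End.isSemisimple_of_squarefree_aeval_eq_zero (p := Polynomial.X ^ m - 1)
    · apply Polynomial.Separable.squarefree
      have := Polynomial.separable_X_pow_sub_C (F := ℝ) (n := m) 1 (by exact_mod_cast hm.ne')
        one_ne_zero
      simpa using this
    · simp [hE]
  have h2 : (E ^ 2 - 1).IsSemisimple := by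
    have := hss.aeval (Polynomial.X ^ 2 - 1)
    simpa using this
  exact sub_eq_zero.1 (Module.End.eq_zero_of_isNilpotent_isSemisimple ⟨k, h⟩ h2)

lemma greedy_exists (ρ : ℝ) (hfin : (L ∩ {x | ‖x‖ ≤ ρ} : Set (Fin n → ℝ)).Finite)
    (hspan : (L : Set (Fin n → ℝ)) ⊆ Submodule.span ℝ (L ∩ {x | ‖x‖ ≤ ρ} : Set (Fin n → ℝ))) :
    ∃ vs, Greedy E L vs ∧ (∀ v ∈ vs, ‖v‖ ≤ ρ) ∧
      (L : Set (Fin n → ℝ)) ⊆ Submodule.span ℝ (orb E vs) := by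
  by_contra hcon
  push Not at hcon
  have key : ∀ s : ℕ, ∃ vs, Greedy E L vs ∧ (∀ v ∈ vs, ‖v‖ ≤ ρ) ∧ vs.length = s := by
    intro s
    induction s with
    | zero => exact ⟨[], Greedy.nil, by simp, rfl⟩
    | succ s ih =>
      obtain ⟨ws, h1, h2, h3⟩ := ih
      have hns := hcon ws h1 h2
      have hne : ((L ∩ {x | ‖x‖ ≤ ρ}) \ Submodule.span ℝ (orb E ws) : Set (Fin n → ℝ)).Nonempty := by
        by_contra hemp
        rw [Set.not_nonempty_iff_eq_empty, Set.sdiff_eq_empty] at hemp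
        exact hns (hspan.trans (Submodule.span_le.2 hemp))
      obtain ⟨v, ⟨⟨hvL, hvρ⟩, hvU⟩, hmin⟩ := Set.exists_min_image _ (fun x => ‖x‖)
        (hfin.subset Set.sdiff_subset) hne
      refine ⟨v :: ws, Greedy.cons v ws h1 hvL hvU fun w hw hwU => ?_, ?_, by simp [h3]⟩
      · by_cases hwρ : ‖w‖ ≤ ρ
        · exact hmin w ⟨⟨hw, hwρ⟩, hwU⟩
        · exact le_trans hvρ (not_le.1 hwρ).le
      · intro w hw
        rcases List.mem_cons.1 hw with rfl | h
        · exact hvρ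
        · exact h2 w h
  obtain ⟨vs, h1, -, h3⟩ := key (n + 1)
  have h4 := h1.length_le
  have h5 := Submodule.finrank_le (Submodule.span ℝ (orb E vs))
  rw [Module.finrank_fin_fun] at h5
  omega

lemma greedy_final (E : End ℝ (Fin n → ℝ)) {m : ℕ} (hm : 0 < m) (hE : E ^ m = 1) :
    ∃ c : ℕ, 0 < c ∧ ∀ (L : AddSubgroup (Fin n → ℝ)) (ρ : ℝ), (∀ x ∈ L, E x ∈ L) →
      (L ∩ {x | ‖x‖ ≤ ρ} : Set (Fin n → ℝ)).Finite →
      (L : Set (Fin n → ℝ)) ⊆ Submodule.span ℝ (L ∩ {x | ‖x‖ ≤ ρ} : Set (Fin n → ℝ)) →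
      ∃ vs, Greedy E L vs ∧ (∀ v ∈ vs, ‖v‖ ≤ ρ) ∧
      (L : Set (Fin n → ℝ)) ⊆ Submodule.span ℝ (orb E vs) ∧
      ∀ x ∈ L, c • x ∈ AddSubgroup.closure (orb E vs) := by
  choose c hc h using greedy_bound E hm hE
  refine ⟨∏ s ∈ Finset.range (n + 1), c s, Finset.prod_pos fun s _ => hc s,
    fun L ρ hL hfin hspan => ?_⟩
  obtain ⟨vs, h1, h2, h3⟩ := greedy_exists (E := E) ρ hfin hspan
  refine ⟨vs, h1, h2, h3, fun x hx => ?_⟩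
  have h4 := h1.length_le
  have h5 := Submodule.finrank_le (Submodule.span ℝ (orb E vs))
  rw [Module.finrank_fin_fun] at h5
  obtain ⟨q, hq⟩ := Finset.dvd_prod_of_mem c (Finset.mem_range.2 (show vs.length < n + 1 by omega))
  rw [hq, mul_comm, mul_smul]
  exact AddSubgroup.nsmul_mem _ (h _ L hL vs h1 rfl x hx (h3 hx)) q
end

lemma core_list {n : ℕ} (E : End ℝ (Fin n → ℝ)) {m : ℕ} (hm : 0 < m) (hE : E ^ m = 1)
    (hE1 : E ≠ 1) (hE2 : E ≠ -1) :
    ∃ c : ℕ, 0 < c ∧ ∀ (L : AddSubgroup (Fin n → ℝ)) (ρ : ℝ), 0 ≤ ρ → (∀ x ∈ L, E x ∈ L) →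
      (∀ r : ℝ, (L ∩ {x | ‖x‖ ≤ r} : Set (Fin n → ℝ)).Finite) →
      Submodule.span ℝ (L ∩ {x | ‖x‖ ≤ ρ} : Set (Fin n → ℝ)) = ⊤ →
      ∃ vs : List (Fin n → ℝ), vs.length ≤ n - 1 ∧ (∀ v ∈ vs, v ∈ L ∧ ‖v‖ ≤ c * ρ) ∧
      ∀ x ∈ L, c • x ∈ AddSubgroup.closure (orb E vs) := by
  obtain ⟨c, hc, hg⟩ := greedy_final E hm hE
  by_cases hsq : E ^ 2 = 1
  swap
  · refine ⟨c, hc, fun L ρ hρ hL hfin hspan => ?_⟩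
    obtain ⟨vs, h1, h2, h3, h4⟩ := hg L ρ hL (hfin ρ) (by rw [hspan]; simp)
    refine ⟨vs, ?_, fun v hv => ⟨h1.mem v hv, (h2 v hv).trans ?_⟩, h4⟩
    · by_contra hlen
      have h5 := Submodule.finrank_le (Submodule.span ℝ (orb E vs))
      rw [Module.finrank_fin_fun] at h5
      rcases h1.flag hm hE with h | h
      · omega
      · apply hsq
        apply sq_eq_one_of_nilp hm hE (k := vs.length)
        have htop : Submodule.span ℝ (orb E vs) = ⊤ := by
          rw [eq_top_iff, ← hspan, Submodule.span_le]
          exact Set.inter_subset_left.trans h3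
        ext1 x
        ext1
        simp only [LinearMap.comp_apply]
        rw [h _ (by rw [htop]; trivial)]
        simp
    · have : (1 : ℝ) ≤ c := by exact_mod_cast hc
      nlinarith
  · have hEE : ∀ x, E (E x) = x := by
      intro x
      have := LinearMap.congr_fun hsq x
      rwa [pow_two] at this
    obtain ⟨C, hC⟩ := pow_bound E hm hE
    have hC1 : ∀ v, ‖E v‖ ≤ C * ‖v‖ := fun v => by simpa using hC 1 v
    -- the general half
    have half : ∀ (F : End ℝ (Fin n → ℝ)) (a : ℝ), (∀ x, E (F x) = a • F x) → F ≠ 0 →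
        (∀ x, ‖F x‖ ≤ (1 + C) * ‖x‖) →
        ∀ (L : AddSubgroup (Fin n → ℝ)) (ρ : ℝ), 0 ≤ ρ → (∀ x ∈ L, E x ∈ L) →
        (∀ x ∈ L, F x ∈ L) →
        (∀ r : ℝ, (L ∩ {x | ‖x‖ ≤ r} : Set (Fin n → ℝ)).Finite) →
        Submodule.span ℝ (L ∩ {x | ‖x‖ ≤ ρ} : Set (Fin n → ℝ)) = ⊤ →
        ∃ v ws, (∀ w ∈ v :: ws, w ∈ L ∧ ‖w‖ ≤ (1 + C) * ρ ∧ E w = a • w) ∧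
          (v :: ws).length ≤ finrank ℝ (LinearMap.ker (E - a • 1)) ∧
          ∀ x ∈ L, c • F x ∈ AddSubgroup.closure (orb E (v :: ws)) := by
      intro F a hFa hF0 hFn L ρ hρ hL hLF hfin hspan
      set L' : AddSubgroup (Fin n → ℝ) := L.map F.toAddMonoidHom with hL'
      have hmemL' : ∀ y, y ∈ L' ↔ ∃ x ∈ L, F x = y := by
        intro y; rw [hL', AddSubgroup.mem_map]; rfl
      have hL'L : ∀ y ∈ L', y ∈ L := by
        intro y hy
        obtain ⟨x, hx, rfl⟩ := (hmemL' y).1 hy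
        exact hLF x hx
      have hL'a : ∀ y ∈ L', E y = a • y := by
        intro y hy
        obtain ⟨x, hx, rfl⟩ := (hmemL' y).1 hy
        exact hFa x
      have hL'E : ∀ y ∈ L', E y ∈ L' := by
        intro y hy
        have h1 := hL'a y hy
        obtain ⟨x, hx, rfl⟩ := (hmemL' y).1 hy
        have ha2 : a * a = 1 ∨ F x = 0 := by
          by_cases h0 : F x = 0
          · exact Or.inr h0
          left
          have h2 := hEE (F x)
          rw [h1, map_smul, h1, smul_smul] at h2
          have h3 : (a * a - 1) • F x = 0 := by rw [sub_smul, h2, one_smul, sub_self]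
          rcases smul_eq_zero.1 h3 with h | h
          · linarith
          · exact absurd h h0
        rw [h1]
        rcases ha2 with h | h
        · rcases mul_self_eq_one_iff.1 h with rfl | rfl
          · simpa using hy
          · simpa using hy
        · rw [h, smul_zero]; exact L'.zero_mem
      obtain ⟨vs, h1, h2, h3, h4⟩ := hg L' ((1 + C) * ρ) hL'E
        ((hfin ((1 + C) * ρ)).subset (fun y hy => ⟨hL'L y hy.1, hy.2⟩)) (by
          intro y hy
          obtain ⟨x, hx, rfl⟩ := (hmemL' y).1 hy
          have hx' : x ∈ Submodule.span ℝ (L ∩ {x | ‖x‖ ≤ ρ} : Set (Fin n → ℝ)) := by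
            rw [hspan]; trivial
          have h5 : Submodule.span ℝ (L ∩ {x | ‖x‖ ≤ ρ} : Set (Fin n → ℝ)) ≤
              (Submodule.span ℝ (L' ∩ {x | ‖x‖ ≤ (1 + C) * ρ} : Set (Fin n → ℝ))).comap F := by
            rw [Submodule.span_le]
            rintro z ⟨hz1, hz2⟩
            refine Submodule.subset_span ⟨(hmemL' _).2 ⟨z, hz1, rfl⟩, (hFn z).trans ?_⟩
            have hz2' : ‖z‖ ≤ ρ := hz2
            gcongr
          exact h5 hx')
      cases vs with
      | nil =>
        exfalso
        apply hF0
        have h5 : (⊤ : Submodule ℝ (Fin n → ℝ)) ≤ LinearMap.ker F := by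
          rw [← hspan, Submodule.span_le]
          rintro z ⟨hz1, -⟩
          have := h3 ((hmemL' _).2 ⟨z, hz1, rfl⟩)
          rw [orb_nil, Submodule.span_empty] at this
          simpa using this
        exact LinearMap.ker_eq_top.1 (top_le_iff.1 h5)
      | cons v ws =>
        refine ⟨v, ws, fun w hw => ⟨hL'L _ (h1.mem w hw), h2 w hw, hL'a _ (h1.mem w hw)⟩, ?_,
          fun x hx => h4 _ ((hmemL' _).2 ⟨x, hx, rfl⟩)⟩
        refine h1.length_le.trans (Submodule.finrank_mono ?_)
        rw [Submodule.span_le]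
        intro y hy
        have : y ∈ L' := closure_le_of_inv hL'E h1.mem (AddSubgroup.subset_closure hy)
        simp [hL'a y this]
    have hnorm : ∀ x, ‖E x‖ + ‖x‖ ≤ (1 + C) * ‖x‖ := fun x => by linarith [hC1 x]
    have hp := half (1 + E) 1 (by intro x; simp [hEE, add_comm])
      (by intro h; exact hE2 (eq_neg_of_add_eq_zero_right h))
      (by
        intro x
        refine le_trans ?_ (hnorm x)
        rw [add_comm ‖E x‖]
        exact norm_add_le _ _)
    have hq := half (1 - E) (-1) (by intro x; simp [hEE])
      (by intro h; exact hE1 (sub_eq_zero.1 h).symm)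
      (by
        intro x
        refine le_trans ?_ (hnorm x)
        rw [add_comm ‖E x‖]
        exact norm_sub_le _ _)
    refine ⟨(4 * c) * (4 * (1 + C)), by positivity, fun L ρ hρ hL hfin hspan => ?_⟩
    obtain ⟨v, vs, hv1, hv2, hv3⟩ := hp L ρ hρ hL (fun x hx => L.add_mem hx (hL x hx)) hfin hspan
    obtain ⟨w, ws, hw1, hw2, hw3⟩ := hq L ρ hρ hL (fun x hx => L.sub_mem hx (hL x hx)) hfin hspan
    have hdim : finrank ℝ (LinearMap.ker (E - (1 : ℝ) • 1)) +
        finrank ℝ (LinearMap.ker (E - (-1 : ℝ) • 1)) ≤ n := by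
      rw [← Submodule.finrank_sup_add_finrank_inf_eq]
      have h0 : LinearMap.ker (E - (1 : ℝ) • 1) ⊓ LinearMap.ker (E - (-1 : ℝ) • 1) = ⊥ := by
        rw [eq_bot_iff]
        rintro x ⟨hx1, hx2⟩
        simp only [SetLike.mem_coe, LinearMap.mem_ker, LinearMap.sub_apply, LinearMap.smul_apply,
          Module.End.one_apply, one_smul, neg_smul, sub_neg_eq_add] at hx1 hx2
        rw [Submodule.mem_bot]
        have : (2 : ℝ) • x = 0 := by
          rw [two_smul]
          calc x + x = (E x + x) - (E x - x) := by abel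
            _ = 0 := by rw [hx1, hx2, sub_zero]
        simpa using this
      rw [h0, finrank_bot, add_zero]
      exact (Submodule.finrank_le _).trans (by simp)
    set us := (v + w) :: (vs ++ ws) with hus
    have hin : ∀ x ∈ us, x ∈ AddSubgroup.closure (orb E us) :=
      fun x hx => AddSubgroup.subset_closure (mem_orb hx)
    have hEin : E (v + w) ∈ AddSubgroup.closure (orb E us) :=
      AddSubgroup.subset_closure ⟨v + w, by simp [hus], 1, by simp⟩
    have hvw := hin (v + w) (by simp [hus])
    have hEv : E v = v := by simpa using (hv1 v (by simp)).2.2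
    have hEw : E w = -w := by simpa using (hw1 w (by simp)).2.2
    have h2v : ∀ x ∈ AddSubgroup.closure (orb E (v :: vs)),
        2 • x ∈ AddSubgroup.closure (orb E us) := by
      intro x hx
      have h1 : AddSubgroup.closure (orb E (v :: vs)) ≤
          (AddSubgroup.closure (orb E us)).comap (nsmulAddMonoidHom 2) := by
        rw [AddSubgroup.closure_le]
        rintro y ⟨z, hz, j, rfl⟩
        have hEz : E z = z := by simpa using (hv1 z hz).2.2
        have hz' : (E ^ j) z = z := by
          induction j with
          | zero => simp
          | succ j ih => rw [pow_succ, Module.End.mul_apply, hEz, ih]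
        rw [hz']
        change 2 • z ∈ AddSubgroup.closure (orb E us)
        rcases List.mem_cons.1 hz with rfl | h
        · have := AddSubgroup.add_mem _ hvw hEin
          rw [map_add, hEv, hEw] at this
          convert this using 1
          module
        · exact AddSubgroup.nsmul_mem _ (hin z (by simp [hus, h])) 2
      exact h1 hx
    have h2w : ∀ x ∈ AddSubgroup.closure (orb E (w :: ws)),
        2 • x ∈ AddSubgroup.closure (orb E us) := by
      intro x hx
      have h1 : AddSubgroup.closure (orb E (w :: ws)) ≤
          (AddSubgroup.closure (orb E us)).comap (nsmulAddMonoidHom 2) := by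
        rw [AddSubgroup.closure_le]
        rintro y ⟨z, hz, j, rfl⟩
        have hEz : E z = -z := by simpa using (hw1 z hz).2.2
        have hz' : (E ^ j) z = z ∨ (E ^ j) z = -z := by
          induction j with
          | zero => simp
          | succ j ih =>
            rw [pow_succ, Module.End.mul_apply, hEz, map_neg, neg_inj, neg_eq_iff_eq_neg]
            exact ih.symm
        have hz2 : 2 • z ∈ AddSubgroup.closure (orb E us) := by
          rcases List.mem_cons.1 hz with rfl | h
          · have := AddSubgroup.sub_mem _ hvw hEin
            rw [map_add, hEv, hEw] at this
            convert this using 1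
            module
          · exact AddSubgroup.nsmul_mem _ (hin z (by simp [hus, h])) 2
        change 2 • (E ^ j) z ∈ AddSubgroup.closure (orb E us)
        rcases hz' with h | h
        · rw [h]; exact hz2
        · rw [h, smul_neg]; exact AddSubgroup.neg_mem _ hz2
      exact h1 hx
    refine ⟨us, ?_, ?_, ?_⟩
    · simp only [hus, List.length_cons, List.length_append] at *
      omega
    · have hle : (1 + C) * ρ + (1 + C) * ρ ≤ (((4 * c) * (4 * (1 + C)) : ℕ) : ℝ) * ρ := by
        push_cast
        have : (1 : ℝ) ≤ c := by exact_mod_cast hc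
        have h0 : 0 ≤ (1 + C) * ρ := by positivity
        nlinarith
      have h0 : 0 ≤ (1 + C) * ρ := by positivity
      intro x hx
      rcases List.mem_cons.1 hx with rfl | h
      · refine ⟨L.add_mem (hv1 v (by simp)).1 (hw1 w (by simp)).1, (norm_add_le _ _).trans ?_⟩
        linarith [(hv1 v (by simp)).2.1, (hw1 w (by simp)).2.1]
      · rcases List.mem_append.1 h with h | h
        · have := hv1 x (by simp [h])
          exact ⟨this.1, by linarith [this.2.1]⟩
        · have := hw1 x (by simp [h])
          exact ⟨this.1, by linarith [this.2.1]⟩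
    · intro x hx
      have h1 := AddSubgroup.nsmul_mem _
        (AddSubgroup.add_mem _ (h2v _ (hv3 x hx)) (h2w _ (hw3 x hx))) (4 * (1 + C))
      convert h1 using 1
      simp only [LinearMap.add_apply, LinearMap.sub_apply, Module.End.one_apply]
      module

lemma core_fun {n : ℕ} (E : End ℝ (Fin n → ℝ)) {m : ℕ} (hm : 0 < m) (hE : E ^ m = 1)
    (hE1 : E ≠ 1) (hE2 : E ≠ -1) :
    ∃ c : ℕ, 0 < c ∧ ∀ (L : AddSubgroup (Fin n → ℝ)) (ρ : ℝ), 0 ≤ ρ → (∀ x ∈ L, E x ∈ L) →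
      (∀ r : ℝ, (L ∩ {x | ‖x‖ ≤ r} : Set (Fin n → ℝ)).Finite) →
      Submodule.span ℝ (L ∩ {x | ‖x‖ ≤ ρ} : Set (Fin n → ℝ)) = ⊤ →
      ∃ u : Fin (n - 1) → (Fin n → ℝ), (∀ i, u i ∈ L ∧ ‖u i‖ ≤ c * ρ) ∧
      ∀ x ∈ L, ∃ a : Fin (n - 1) × Fin m → ℤ, c • x = ∑ p, a p • (E ^ (p.2 : ℕ)) (u p.1) := by
  obtain ⟨c, hc, h⟩ := core_list E hm hE hE1 hE2
  refine ⟨c, hc, fun L ρ hρ hL hfin hspan => ?_⟩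
  obtain ⟨vs, h1, h2, h3⟩ := h L ρ hρ hL hfin hspan
  refine ⟨fun i => vs.getD i 0, fun i => ?_, fun x hx => ?_⟩
  · beta_reduce
    by_cases hi : (i : ℕ) < vs.length
    · rw [List.getD_eq_getElem _ _ hi]
      exact h2 _ (List.getElem_mem hi)
    · rw [List.getD_eq_default _ _ (not_lt.1 hi)]
      exact ⟨L.zero_mem, by rw [norm_zero]; positivity⟩
  · have key := h3 x hx
    generalize c • x = y at key
    induction key using AddSubgroup.closure_induction with
    | mem y hy =>
      obtain ⟨v, hv, j, rfl⟩ := hy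
      obtain ⟨i, hi, rfl⟩ := List.getElem_of_mem hv
      refine ⟨Pi.single (⟨i, by omega⟩, ⟨j % m, Nat.mod_lt _ hm⟩) 1, ?_⟩
      rw [Finset.sum_eq_single (⟨i, by omega⟩, ⟨j % m, Nat.mod_lt _ hm⟩)]
      · simp only [Pi.single_eq_same, one_smul]
        rw [← pow_mod_orb hE, List.getD_eq_getElem _ _ hi]
      · intro p _ hp
        rw [Pi.single_eq_of_ne hp, zero_smul]
      · simp
    | zero => exact ⟨0, by simp⟩
    | add y z _ _ hy hz =>
      obtain ⟨a, rfl⟩ := hy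
      obtain ⟨b, rfl⟩ := hz
      exact ⟨a + b, by simp [add_smul, Finset.sum_add_distrib]⟩
    | neg y _ hy =>
      obtain ⟨a, rfl⟩ := hy
      exact ⟨-a, by simp⟩

/-- recovering a lattice from the finite data -/
lemma recover {V ι : Type*} [AddCommGroup V] [Module ℝ V] [Fintype ι] (c : ℕ) (hc : 0 < c)
    (e : ι → V)
    (L₁ L₂ : AddSubgroup V) (he₁ : ∀ i, e i ∈ L₁) (he₂ : ∀ i, e i ∈ L₂)
    (h₁ : ∀ x ∈ L₁, ∃ a : ι → ℤ, c • x = ∑ i, a i • e i)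
    (hT : {z : ι → Fin c | ∃ l ∈ L₁, c • l = ∑ i, ((z i : ℕ) : ℤ) • e i} =
      {z : ι → Fin c | ∃ l ∈ L₂, c • l = ∑ i, ((z i : ℕ) : ℤ) • e i}) : L₁ ≤ L₂ := by
  intro x hx
  obtain ⟨a, ha⟩ := h₁ x hx
  have hc' : (c : ℤ) ≠ 0 := by exact_mod_cast hc.ne'
  set b : V := ∑ i, (a i / c) • e i with hb
  have hz : ∀ i, ((a i % c).toNat : ℤ) = a i % c := fun i => Int.toNat_of_nonneg (Int.emod_nonneg _ hc')
  let z : ι → Fin c := fun i => ⟨(a i % c).toNat, by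
    have := Int.emod_lt_of_pos (a i) (show (0 : ℤ) < c by exact_mod_cast hc)
    have := hz i
    omega⟩
  have hsum : c • (x - b) = ∑ i, ((z i : ℕ) : ℤ) • e i := by
    rw [smul_sub, ha, hb, Finset.smul_sum, ← Finset.sum_sub_distrib]
    refine Finset.sum_congr rfl fun i _ => ?_
    have h2 : ((z i : ℕ) : ℤ) = a i - c * (a i / c) := by
      change ((a i % c).toNat : ℤ) = _
      rw [hz, Int.emod_def]
    rw [h2, sub_smul, mul_smul, natCast_zsmul]
  have hmem : z ∈ {z : ι → Fin c | ∃ l ∈ L₁, c • l = ∑ i, ((z i : ℕ) : ℤ) • e i} :=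
    ⟨x - b, L₁.sub_mem hx (L₁.sum_mem fun i _ => L₁.zsmul_mem (he₁ i) _), hsum⟩
  rw [hT] at hmem
  obtain ⟨l, hl, hl2⟩ := hmem
  rw [← hsum] at hl2
  have h3 : (c : ℝ) • l = (c : ℝ) • (x - b) := by rw [Nat.cast_smul_eq_nsmul, Nat.cast_smul_eq_nsmul, hl2]
  have h4 : l = x - b := smul_right_injective V (show (c : ℝ) ≠ 0 by exact_mod_cast hc.ne') h3
  have h5 : x = l + b := by rw [h4]; abel
  rw [h5]
  exact L₂.add_mem hl (L₂.sum_mem fun i _ => L₂.zsmul_mem (he₂ i) _)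

section group
open Pointwise

/-- cast of an integer vector -/
def castV {n : ℕ} (z : Fin n → ℤ) : Fin n → ℝ := fun i => (z i : ℝ)

lemma end_ext {n : ℕ} {F G : End ℝ (Fin n → ℝ)} (h : ∀ z : Fin n → ℤ, F (castV z) = G (castV z)) :
    F = G := by
  apply LinearMap.pi_ext'
  intro i
  ext1
  have := h (Pi.single i 1)
  have hc : castV (Pi.single i (1 : ℤ)) = Pi.single i (1 : ℝ) := by
    ext j
    by_cases hj : j = i
    · subst hj; simp [castV]
    · simp [castV, Pi.single_eq_of_ne hj]
  rw [hc] at this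
  simpa using this

lemma setup {H : Type*} [Group H] {n : ℕ} (A : Subgroup H) [A.Normal]
    (φ : A ≃* Multiplicative (Fin n → ℤ)) :
    ∃ (ι : A → (Fin n → ℝ)) (E : H → End ℝ (Fin n → ℝ)),
      (∀ x y, ι (x * y) = ι x + ι y) ∧ (∀ x, ∃ z, ι x = castV z) ∧ (∀ z, ∃ x, ι x = castV z) ∧
      Function.Injective ι ∧ ∀ h x, E h (ι x) = ι (MulAut.conjNormal h x) := by
  let θ : H → ((Fin n → ℤ) →+ (Fin n → ℤ)) := fun h =>
    { toFun := fun z => (φ (MulAut.conjNormal h (φ.symm (Multiplicative.ofAdd z)))).toAdd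
      map_zero' := by simp
      map_add' := by intro x y; simp }
  refine ⟨fun x => castV (φ x).toAdd, fun h =>
    Matrix.mulVecLin ((LinearMap.toMatrix' (θ h).toIntLinearMap).map (Int.castRingHom ℝ)),
    ?_, ?_, ?_, ?_, ?_⟩
  · intro x y
    ext i
    simp [castV]
  · intro x
    exact ⟨_, rfl⟩
  · intro z
    exact ⟨φ.symm (Multiplicative.ofAdd z), by simp⟩
  · intro x y h
    apply φ.injective
    apply Multiplicative.toAdd.injective
    ext i
    have := congrFun h i
    simpa [castV] using this
  · intro h x
    have h1 : θ h (φ x).toAdd = (φ (MulAut.conjNormal h x)).toAdd := by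
      simp [θ]
    beta_reduce
    rw [← h1]
    have h2 : (LinearMap.toMatrix' (θ h).toIntLinearMap).mulVec (φ x).toAdd = θ h (φ x).toAdd := by
      rw [LinearMap.toMatrix'_mulVec]; rfl
    rw [← h2]
    ext i
    rw [Matrix.mulVecLin_apply]
    exact (RingHom.map_mulVec (Int.castRingHom ℝ) _ _ i).symm

lemma crossed {H : Type*} [Group H] {n : ℕ} (A : Subgroup H) [A.Normal] [A.FiniteIndex]
    (ι : A → (Fin n → ℝ)) (E : H → End ℝ (Fin n → ℝ))
    (hι : ∀ x y, ι (x * y) = ι x + ι y)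
    (hE : ∀ h x, E h (ι x) = ι (MulAut.conjNormal h x)) :
    ∃ f : H → (Fin n → ℝ), (∀ x y, f (x * y) = f x + E x (f y)) ∧
      ∀ x : A, f x = (A.index : ℝ) • ι x := by
  classical
  let _ : Fintype (H ⧸ A) := Subgroup.fintypeQuotientOfFiniteIndex
  have hmem : ∀ (h : H) (q : H ⧸ A), h * q.out * (h • q).out⁻¹ ∈ A := by
    intro h q
    have h1 : ((h * q.out : H) : H ⧸ A) = ((h • q).out : H) := by
      rw [QuotientGroup.out_eq']
      conv_rhs => rw [← QuotientGroup.out_eq' q]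
      rfl
    have h2 := QuotientGroup.eq.1 h1.symm
    exact (Subgroup.Normal.mem_comm_iff inferInstance).1 h2
  let c : H → H ⧸ A → A := fun h q => ⟨_, hmem h q⟩
  refine ⟨fun h => ∑ q, ι (c h q), ?_, ?_⟩
  · intro x y
    have h1 : ∀ q, ι (c (x * y) q) = ι (c x (y • q)) + E x (ι (c y q)) := by
      intro q
      rw [hE, ← hι]
      have h2 : c (x * y) q = MulAut.conjNormal x (c y q) * c x (y • q) := by
        apply Subtype.ext
        simp only [c, Subgroup.coe_mul, MulAut.conjNormal_apply, mul_smul]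
        group
      rw [h2, hι, hι, add_comm]
    beta_reduce
    rw [Finset.sum_congr rfl fun q _ => h1 q, Finset.sum_add_distrib, map_sum]
    congr 1
    exact Equiv.sum_comp (MulAction.toPerm y) (fun q => ι (c x q))
  · intro x
    have h1 : ∀ q, c x q = x := by
      intro q
      apply Subtype.ext
      have h2 : (x : H) • q = q := by
        induction q using QuotientGroup.induction_on with
        | H g =>
          change (((x : H) * g : H) : H ⧸ A) = g
          rw [QuotientGroup.eq]
          have := Subgroup.Normal.conj_mem (inferInstance : A.Normal) _ (A.inv_mem x.2) g⁻¹
          simpa [mul_assoc] using this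
      simp [c, h2]
    simp only [h1, Finset.sum_const, Finset.card_univ]
    rw [Subgroup.index_eq_card, Nat.card_eq_fintype_card, Nat.cast_smul_eq_nsmul]

lemma word_exists {H : Type*} [Group H] (S : Set H) (hS : Subgroup.closure S = ⊤) (h : H) :
    ∃ w : List H, (∀ g ∈ w, g ∈ S ∪ S⁻¹) ∧ w.prod = h ∧ w.length = wordLength S h := by
  have hne : {ℓ : ℕ | ∃ w : List H, (∀ g ∈ w, g ∈ S ∪ S⁻¹) ∧ w.prod = h ∧ w.length = ℓ}.Nonempty := by
    obtain ⟨l, hl, hl2⟩ := Submonoid.exists_list_of_mem_closure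
      (s := S ∪ S⁻¹) (x := h) (by rw [← Subgroup.closure_toSubmonoid, hS]; trivial)
    exact ⟨l.length, l, hl, hl2, rfl⟩
  exact Nat.sInf_mem hne

lemma diam_word {H : Type*} [Group H] (S : Set H) (hS : Subgroup.closure S = ⊤)
    (N : Subgroup H) [N.FiniteIndex] (k : ℕ) (hk : quotDiam S N ≤ k) (h : H) :
    ∃ ν ∈ N, ∃ w : List H, (∀ g ∈ w, g ∈ S ∪ S⁻¹) ∧ w.prod = h * ν ∧ w.length ≤ k := by
  set F : H → ℕ := fun h : H => sInf {ℓ : ℕ | ∃ n ∈ N, wordLength S (h * n) = ℓ} with hF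
  have : Finite (H ⧸ N) := Subgroup.finite_quotient_of_finiteIndex
  have hcos : ∀ h : H, F ((QuotientGroup.mk h : H ⧸ N).out) = F h := by
    intro h
    obtain ⟨x, hx⟩ := QuotientGroup.mk_out_eq_mul N h
    rw [hx]
    simp only [hF]
    congr 1
    ext ℓ
    constructor
    · rintro ⟨y, hy, h1⟩
      exact ⟨x * y, N.mul_mem x.2 hy, by rw [← mul_assoc]; exact h1⟩
    · rintro ⟨y, hy, h1⟩
      exact ⟨(x : H)⁻¹ * y, N.mul_mem (N.inv_mem x.2) hy, by rw [← h1]; congr 1; group⟩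
  have hbdd : BddAbove (Set.range F) := by
    apply Set.Finite.bddAbove
    apply (Set.finite_range fun q : H ⧸ N => F q.out).subset
    rintro _ ⟨h, rfl⟩
    exact ⟨h, hcos h⟩
  have h1 : F h ≤ k := (le_csSup hbdd ⟨h, rfl⟩).trans hk
  have hne : {ℓ : ℕ | ∃ n ∈ N, wordLength S (h * n) = ℓ}.Nonempty := ⟨_, 1, N.one_mem, rfl⟩
  obtain ⟨ν, hν, hν2⟩ := Nat.sInf_mem hne
  obtain ⟨w, hw1, hw2, hw3⟩ := word_exists S hS (h * ν)
  refine ⟨ν, hν, w, hw1, hw2, ?_⟩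
  rw [hw3, hν2]
  exact h1

lemma span_near {n : ℕ} (L : Set (Fin n → ℝ)) (K r : ℝ) (hKr : (n + 1) * r < K)
    (h : ∀ i : Fin n, ∃ l ∈ L, ‖l - K • (Pi.single i 1 : Fin n → ℝ)‖ ≤ r) :
    Submodule.span ℝ (L ∩ {x | ‖x‖ ≤ K + r} : Set (Fin n → ℝ)) = ⊤ := by
  choose l hl hlr using h
  have hcoord : ∀ i j : Fin n, |l i j - K * (Pi.single i (1 : ℝ) : Fin n → ℝ) j| ≤ r := fun i j => by
    have := (norm_le_pi_norm (l i - K • (Pi.single i 1 : Fin n → ℝ)) j).trans (hlr i)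
    simpa using this
  have hdet : (Matrix.of l).det ≠ 0 := by
    apply det_ne_zero_of_sum_row_lt_diag
    intro i
    have hr : 0 ≤ r := (norm_nonneg _).trans (hlr i)
    have h1 : ∑ j ∈ Finset.univ.erase i, ‖Matrix.of l i j‖ ≤ ∑ j ∈ Finset.univ.erase i, r := by
      refine Finset.sum_le_sum fun j hj => ?_
      have := hcoord i j
      rw [Pi.single_eq_of_ne (Finset.ne_of_mem_erase hj)] at this
      simpa using this
    have h2 : ∑ j ∈ Finset.univ.erase i, r ≤ n * r := by
      rw [Finset.sum_const, nsmul_eq_mul]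
      gcongr
      exact (Finset.card_erase_le).trans (by simp)
    have h3 : K - r ≤ ‖Matrix.of l i i‖ := by
      have := hcoord i i
      rw [Pi.single_eq_same, mul_one, abs_le] at this
      have h4 := le_abs_self (l i i)
      change _ ≤ |l i i|
      linarith
    linarith
  have hli : LinearIndependent ℝ l := Matrix.linearIndependent_rows_of_det_ne_zero hdet
  have htop := hli.span_eq_top_of_card_eq_finrank' (by simp)
  rw [eq_top_iff, ← htop, Submodule.span_le]
  rintro _ ⟨i, rfl⟩
  refine Submodule.subset_span ⟨hl i, ?_⟩
  have hr : 0 ≤ r := (norm_nonneg _).trans (hlr i)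
  have hK : 0 ≤ K := le_trans (by positivity) hKr.le
  have h1 : ‖K • (Pi.single i (1 : ℝ) : Fin n → ℝ)‖ ≤ K := by
    rw [norm_smul, Real.norm_of_nonneg hK, Pi.norm_single]
    simp
  calc ‖l i‖ = ‖K • (Pi.single i 1 : Fin n → ℝ) + (l i - K • (Pi.single i 1 : Fin n → ℝ))‖ := by congr 1; abel
    _ ≤ _ := (norm_add_le _ _).trans (add_le_add h1 (hlr i))

end group

section final

lemma castV_bound {n R : ℕ} {z : Fin n → ℤ} (h : ‖castV z‖ ≤ R) (i : Fin n) :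
    z i ∈ Finset.Icc (-R : ℤ) R := by
  have h1 : |(z i : ℝ)| ≤ R := (norm_le_pi_norm (castV z) i).trans h
  rw [abs_le] at h1
  rw [Finset.mem_Icc]
  exact ⟨by exact_mod_cast h1.1, by exact_mod_cast h1.2⟩

lemma castV_finite {n : ℕ} (r : ℝ) (X : Set (Fin n → ℝ)) (hX : ∀ x ∈ X, ∃ z, x = castV z) :
    (X ∩ {x | ‖x‖ ≤ r}).Finite := by
  obtain ⟨R, hR⟩ := exists_nat_ge r
  have : (Set.pi Set.univ fun _ : Fin n => (Finset.Icc (-R : ℤ) R : Set ℤ)).Finite :=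
    Set.Finite.pi fun _ => Finset.finite_toSet _
  refine (this.image castV).subset ?_
  rintro x ⟨hx, hxr⟩
  obtain ⟨z, rfl⟩ := hX x hx
  exact ⟨z, fun i _ => castV_bound (le_trans hxr hR) i, rfl⟩

lemma castV_single {n : ℕ} (i : Fin n) (a : ℤ) :
    castV (Pi.single i a) = (a : ℝ) • (Pi.single i 1 : Fin n → ℝ) := by
  ext j
  by_cases hj : j = i
  · subst hj; simp [castV]
  · simp [castV, Pi.single_eq_of_ne hj]

lemma E_bound {H : Type*} [Group H] {n : ℕ} (A : Subgroup H) [A.FiniteIndex]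
    (E : H → End ℝ (Fin n → ℝ)) (hmul : ∀ x y, E (x * y) = E x * E y)
    (hA : ∀ x ∈ A, E x = 1) : ∃ C : ℝ, 0 ≤ C ∧ ∀ h v, ‖E h v‖ ≤ C * ‖v‖ := by
  let _ : Fintype (H ⧸ A) := Subgroup.fintypeQuotientOfFiniteIndex
  refine ⟨∑ q : H ⧸ A, ‖LinearMap.toContinuousLinearMap (E q.out)‖,
    Finset.sum_nonneg fun _ _ => norm_nonneg _, fun h v => ?_⟩
  obtain ⟨x, hx⟩ := QuotientGroup.mk_out_eq_mul A h
  have h1 : E h = E (QuotientGroup.mk h : H ⧸ A).out := by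
    rw [hx, hmul, hA x x.2, mul_one]
  rw [h1]
  refine ((LinearMap.toContinuousLinearMap (E (QuotientGroup.mk h : H ⧸ A).out)).le_opNorm v).trans ?_
  gcongr
  exact Finset.single_le_sum (f := fun q : H ⧸ A => ‖LinearMap.toContinuousLinearMap (E q.out)‖)
    (fun _ _ => norm_nonneg _) (Finset.mem_univ _)

lemma near {H : Type*} [Group H] {n : ℕ} (A : Subgroup H) [A.Normal] [A.FiniteIndex]
    (ι : A → (Fin n → ℝ)) (E : H → End ℝ (Fin n → ℝ))
    (hι : ∀ x y, ι (x * y) = ι x + ι y)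
    (hmul : ∀ x y, E (x * y) = E x * E y) (hA : ∀ x ∈ A, E x = 1)
    (f : H → (Fin n → ℝ)) (hf : ∀ x y, f (x * y) = f x + E x (f y))
    (hfA : ∀ x : A, f x = (A.index : ℝ) • ι x)
    (S : Set H) (hSfin : S.Finite) (hS : Subgroup.closure S = ⊤) :
    ∃ C : ℕ, ∀ (k : ℕ) (N : Subgroup H), N.Normal → N.FiniteIndex → quotDiam S N ≤ k →
      ∀ a : A, ∃ l : A, (l : H) ∈ N ∧ ‖ι l - (A.index : ℝ) • ι a‖ ≤ C * k := by
  obtain ⟨C₀, hC₀, hEb⟩ := E_bound A E hmul hA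
  obtain ⟨D, hD⟩ : ∃ D : ℝ, ∀ s ∈ S ∪ S⁻¹, ‖f s‖ ≤ D := by
    have hfin : (S ∪ S⁻¹).Finite := hSfin.union hSfin.inv
    obtain ⟨D, hD⟩ := (hfin.image fun s => ‖f s‖).bddAbove
    exact ⟨D, fun s hs => hD ⟨s, hs, rfl⟩⟩
  obtain ⟨C, hC⟩ := exists_nat_ge (C₀ * D)
  have hf1 : f 1 = 0 := by
    have h1 := hfA 1
    have h2 : ι 1 = 0 := by simpa using hι 1 1
    rw [h2, smul_zero] at h1
    exact h1
  have hword : ∀ w : List H, (∀ g ∈ w, g ∈ S ∪ S⁻¹) → ‖f w.prod‖ ≤ C * w.length := by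
    intro w
    induction w using List.reverseRecOn with
    | nil => simp [hf1]
    | append_singleton w s ih =>
      intro hw
      have h1 := ih fun g hg => hw g (by simp [hg])
      have h2 := hD s (hw s (by simp))
      rw [List.prod_append, List.prod_singleton, hf, List.length_append, List.length_singleton]
      push_cast
      calc _ ≤ ‖f w.prod‖ + ‖E w.prod (f s)‖ := norm_add_le _ _
        _ ≤ C * w.length + C₀ * D := by
          refine add_le_add h1 ((hEb _ _).trans ?_)
          gcongr
        _ ≤ _ := by linarith
  refine ⟨C, fun k N hN hNf hd a => ?_⟩
  obtain ⟨ν, hν, w, hw1, hw2, hw3⟩ := diam_word S hS N k hd (a⁻¹ : A)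
  set M := A.index with hM
  have hMpos : (0 : ℝ) < M := by
    exact_mod_cast Nat.pos_of_ne_zero Subgroup.FiniteIndex.index_ne_zero
  have hpA : ∀ g : H, g ^ M ∈ A := fun g => Subgroup.pow_index_mem A g
  let y : A := ⟨w.prod ^ M, hpA _⟩
  have hy : ‖ι y‖ ≤ C * k := by
    have h1 := hword (List.replicate M w).flatten (by
      intro g hg
      rw [List.mem_flatten] at hg
      obtain ⟨l, hl, hg⟩ := hg
      rw [List.eq_of_mem_replicate hl] at hg
      exact hw1 g hg)
    have h2 : (List.replicate M w).flatten.prod = y := by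
      rw [List.prod_flatten, List.map_replicate, List.prod_replicate]
    have h3 : (List.replicate M w).flatten.length = M * w.length := by
      simp
    rw [h2, hfA, h3, norm_smul, Real.norm_of_nonneg hMpos.le] at h1
    have h4 : (w.length : ℝ) ≤ k := by exact_mod_cast hw3
    have h5 : (M : ℝ) * ‖ι y‖ ≤ M * (C * k) := by
      refine h1.trans ?_
      push_cast
      calc (C : ℝ) * (M * w.length) = M * (C * w.length) := by ring
        _ ≤ _ := by gcongr
    exact le_of_mul_le_mul_left h5 hMpos
  have hιpow : ∀ (x : A) (j : ℕ), ι (x ^ j) = (j : ℝ) • ι x := by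
    intro x j
    induction j with
    | zero => simpa using hι 1 1
    | succ j ih => rw [pow_succ, hι, ih]; push_cast; module
  refine ⟨a ^ M * y, ?_, ?_⟩
  · have hcomm : Commute ((a⁻¹ : A) : H ⧸ (N ⊓ A)) (ν : H ⧸ (N ⊓ A)) := by
      change (((a⁻¹ : A) * ν : H) : H ⧸ (N ⊓ A)) = ((ν * (a⁻¹ : A) : H) : H ⧸ (N ⊓ A))
      rw [QuotientGroup.eq]
      constructor
      · have h1 := hN.conj_mem _ hν (a : H)
        have h2 := N.mul_mem (N.inv_mem hν) (hN.conj_mem _ hν (a : H))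
        convert h2 using 1
        simp
        group
      · have h1 := (inferInstance : A.Normal).conj_mem _ a.2 ν⁻¹
        have h2 := A.mul_mem h1 (A.inv_mem a.2)
        convert h2 using 1
        simp
        group
    have h1 := hcomm.mul_pow M
    have hν1 : ((ν : H ⧸ (N ⊓ A))) ^ M = 1 := by
      rw [← QuotientGroup.mk_pow, QuotientGroup.eq_one_iff]
      exact ⟨N.pow_mem hν M, hpA ν⟩
    rw [hν1, mul_one, ← QuotientGroup.mk_mul, ← hw2, ← QuotientGroup.mk_pow,
      ← QuotientGroup.mk_pow] at h1
    have h2 := (QuotientGroup.eq.1 h1.symm).1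
    convert h2 using 1
    simp [y]
  · rw [hι, hιpow, add_sub_cancel_left]
    exact hy

end final

lemma exists_nonscalar {H : Type*} [Group H] {n : ℕ} (hn : 3 ≤ n)
    (hgen2 : ∃ a b : H, Subgroup.closure {a, b} = ⊤) (A : Subgroup H) [A.FiniteIndex]
    (ι : A → (Fin n → ℝ)) (E : H → End ℝ (Fin n → ℝ)) (hsurj : ∀ z, ∃ x, ι x = castV z)
    (f : H → (Fin n → ℝ)) (hf : ∀ x y, f (x * y) = f x + E x (f y)) (hf1 : f 1 = 0)
    (hfA : ∀ x : A, f x = (A.index : ℝ) • ι x) : ∃ h, E h ≠ 1 ∧ E h ≠ -1 := by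
  by_contra hcon
  push Not at hcon
  obtain ⟨a, b, hab⟩ := hgen2
  have hinv : ∀ (h : H) (U : Submodule ℝ (Fin n → ℝ)) (v : Fin n → ℝ), v ∈ U → E h v ∈ U := by
    intro h U v hv
    by_cases h1 : E h = 1
    · rw [h1]; exact hv
    · rw [hcon h h1]; exact U.neg_mem hv
  have hmem : ∀ h : H, f h ∈ Submodule.span ℝ {f a, f b} := by
    intro h
    have hh : h ∈ Subgroup.closure {a, b} := by rw [hab]; trivial
    induction hh using Subgroup.closure_induction with
    | mem x hx =>
      apply Submodule.subset_span
      rcases hx with rfl | rfl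
      · simp
      · simp
    | one => rw [hf1]; exact Submodule.zero_mem _
    | mul x y _ _ hx hy => rw [hf]; exact Submodule.add_mem _ hx (hinv _ _ _ hy)
    | inv x _ hx =>
      have h1 := hf x⁻¹ x
      rw [inv_mul_cancel, hf1] at h1
      rw [eq_neg_of_add_eq_zero_left h1.symm]
      exact Submodule.neg_mem _ (hinv _ _ _ hx)
  have htop : Submodule.span ℝ {f a, f b} = ⊤ := by
    rw [eq_top_iff, ← (Pi.basisFun ℝ (Fin n)).span_eq, Submodule.span_le]
    rintro _ ⟨i, rfl⟩
    obtain ⟨x, hx⟩ := hsurj (Pi.single i 1)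
    have h1 := hmem x
    rw [hfA, hx, castV_single] at h1
    have h2 : (A.index : ℝ) ≠ 0 := by exact_mod_cast Subgroup.FiniteIndex.index_ne_zero
    have h3 := (Submodule.smul_mem_iff _ h2).1 h1
    simpa using h3
  have h1 := finrank_span_le_card (R := ℝ) ({f a, f b} : Set (Fin n → ℝ))
  rw [htop, finrank_top, Module.finrank_fin_fun] at h1
  have h2 : (({f a, f b} : Set (Fin n → ℝ)).toFinset).card ≤ 2 := by
    rw [Set.toFinset_card, ← Nat.card_eq_fintype_card]
    exact (Set.ncard_insert_le (f a) {f b}).trans (by simp)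
  omega

theorem main_bound {H : Type*} [Group H] (n : ℕ) (hn : 3 ≤ n)
    (hgen2 : ∃ a b : H, Subgroup.closure {a, b} = ⊤)
    (A : Subgroup H) [A.Normal] [A.FiniteIndex]
    (φ : A ≃* Multiplicative (Fin n → ℤ))
    (S : Set H) (hSfin : S.Finite) (hSgen : Subgroup.closure S = ⊤) :
    ∃ C : ℝ, 0 < C ∧ ∀ k : ℕ, 1 ≤ k →
      ({M : Subgroup H | ∃ N : Subgroup H, N.Normal ∧ N.FiniteIndex ∧
          quotDiam S N ≤ k ∧ M = N ⊓ A}.ncard : ℝ) ≤ C * (k : ℝ) ^ (n ^ 2 - 1) := by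
  classical
  obtain ⟨ι, E, hι, hintg, hsurj, hinj, hE⟩ := setup A φ
  have hmul : ∀ x y, E (x * y) = E x * E y := by
    intro x y
    apply end_ext
    intro z
    obtain ⟨a, ha⟩ := hsurj z
    rw [← ha, Module.End.mul_apply, hE, hE, hE, map_mul]
    rfl
  have hcommA : ∀ x y : A, x * y = y * x := fun x y => by
    apply φ.injective
    rw [map_mul, map_mul, mul_comm]
  have hEA : ∀ x ∈ A, E x = 1 := by
    intro x hx
    apply end_ext
    intro z
    obtain ⟨a, ha⟩ := hsurj z
    rw [← ha, hE, Module.End.one_apply]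
    congr 1
    apply Subtype.ext
    rw [MulAut.conjNormal_apply]
    have := congrArg Subtype.val (hcommA ⟨x, hx⟩ a)
    simp only [Subgroup.coe_mul] at this
    rw [this, mul_inv_cancel_right]
  obtain ⟨f, hf, hfA⟩ := crossed A ι E hι hE
  have hι1 : ι 1 = 0 := by simpa using hι 1 1
  have hιinv : ∀ x, ι x⁻¹ = - ι x := fun x => by
    have := hι x x⁻¹
    rw [mul_inv_cancel, hι1] at this
    exact eq_neg_of_add_eq_zero_right this.symm
  have hf1 : f 1 = 0 := by
    have h1 := hfA 1
    rw [hι1, smul_zero] at h1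
    exact h1
  obtain ⟨h, hh1, hh2⟩ := exists_nonscalar hn hgen2 A ι E hsurj f hf hf1 hfA
  set m := A.index with hmdef
  have hm : 0 < m := Nat.pos_of_ne_zero Subgroup.FiniteIndex.index_ne_zero
  have hEm : E h ^ m = 1 := by
    have hp : ∀ j : ℕ, E (h ^ j) = E h ^ j := by
      intro j
      induction j with
      | zero => simpa using hEA 1 A.one_mem
      | succ j ih => rw [pow_succ, pow_succ, hmul, ih]
    rw [← hp]
    exact hEA _ (Subgroup.pow_index_mem A h)
  obtain ⟨c, hc, hcore⟩ := core_fun (E h) hm hEm hh1 hh2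
  obtain ⟨C, hnear⟩ := near A ι E hι hmul hEA f hf hfA S hSfin hSgen
  -- the lattice of a subgroup
  let Lat : Subgroup H → AddSubgroup (Fin n → ℝ) := fun M =>
    { carrier := {v | ∃ x : A, (x : H) ∈ M ∧ ι x = v}
      zero_mem' := ⟨1, M.one_mem, hι1⟩
      add_mem' := by
        rintro _ _ ⟨x, hx, rfl⟩ ⟨y, hy, rfl⟩
        exact ⟨x * y, M.mul_mem hx hy, hι x y⟩
      neg_mem' := by
        rintro _ ⟨x, hx, rfl⟩
        exact ⟨x⁻¹, M.inv_mem hx, hιinv x⟩ }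
  have hLat : ∀ M v, v ∈ Lat M ↔ ∃ x : A, (x : H) ∈ M ∧ ι x = v := fun M v => Iff.rfl
  set C₂ : ℕ := m * (C * (n + 1) + 1) + C with hC₂
  -- data for a given lattice
  have hdata : ∀ k : ℕ, 1 ≤ k → ∀ M : {M : Subgroup H | ∃ N : Subgroup H, N.Normal ∧
      N.FiniteIndex ∧ quotDiam S N ≤ k ∧ M = N ⊓ A},
      ∃ z : Fin (n - 1) → Fin n → Finset.Icc (-(c * (C₂ * k) : ℕ) : ℤ) (c * (C₂ * k) : ℕ),
      (∀ p : Fin (n - 1) × Fin m,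
        (E h ^ (p.2 : ℕ)) (castV fun j => (z p.1 j : ℤ)) ∈ Lat M) ∧
      ∀ x ∈ Lat M, ∃ a : Fin (n - 1) × Fin m → ℤ,
        c • x = ∑ p, a p • (E h ^ (p.2 : ℕ)) (castV fun j => (z p.1 j : ℤ)) := by
    rintro k hk ⟨M, N, hN, hNf, hd, rfl⟩
    have hinv : ∀ x ∈ Lat (N ⊓ A), E h x ∈ Lat (N ⊓ A) := by
      rintro _ ⟨x, hx, rfl⟩
      refine ⟨MulAut.conjNormal h x, ⟨?_, (MulAut.conjNormal h x).2⟩, (hE h x).symm⟩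
      rw [MulAut.conjNormal_apply]
      exact hN.conj_mem _ hx.1 h
    have hkR : (1 : ℝ) ≤ k := by exact_mod_cast hk
    have hmR : (1 : ℝ) ≤ m := by exact_mod_cast hm
    have hspan := span_near (Lat (N ⊓ A) : Set (Fin n → ℝ))
      (m * ((C * (n + 1) + 1) * k)) (C * k) (by
        have h1 : (0 : ℝ) ≤ (C * (n + 1) + 1) * k := by positivity
        nlinarith) (by
        intro i
        obtain ⟨a, ha⟩ := hsurj (Pi.single i (((C * (n + 1) + 1) * k : ℕ) : ℤ))
        obtain ⟨l, hl, hl2⟩ := hnear k N hN hNf hd a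
        refine ⟨ι l, ⟨l, ⟨hl, l.2⟩, rfl⟩, ?_⟩
        rw [ha, castV_single, smul_smul] at hl2
        push_cast at hl2
        exact hl2)
    have hρ : (m : ℝ) * ((C * (n + 1) + 1) * k) + C * k = ((C₂ * k : ℕ) : ℝ) := by
      rw [hC₂]; push_cast; ring
    rw [hρ] at hspan
    have hLint : ∀ x ∈ Lat (N ⊓ A), ∃ z, x = castV z := by
      rintro _ ⟨x, -, rfl⟩
      exact hintg x
    obtain ⟨u, hu1, hu2⟩ := hcore (Lat (N ⊓ A)) ((C₂ * k : ℕ) : ℝ) (by positivity) hinv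
      (fun r => castV_finite r _ hLint) hspan
    choose z hz using fun i => hLint (u i) (hu1 i).1
    have hzb : ∀ i j, z i j ∈ Finset.Icc (-(c * (C₂ * k) : ℕ) : ℤ) (c * (C₂ * k) : ℕ) := by
      intro i j
      apply castV_bound
      rw [← hz]
      exact_mod_cast (hu1 i).2
    refine ⟨fun i j => ⟨z i j, hzb i j⟩, ?_, ?_⟩
    · rintro ⟨i, j⟩
      change (E h ^ (j : ℕ)) (castV (z i)) ∈ _
      rw [← hz]
      generalize (j : ℕ) = j
      induction j with
      | zero => simpa using (hu1 i).1
      | succ j ih => rw [pow_succ']; exact hinv _ ih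
    · intro x hx
      obtain ⟨a, ha⟩ := hu2 x hx
      refine ⟨a, ha.trans (Finset.sum_congr rfl fun p _ => ?_)⟩
      rw [hz]
  set B : ℕ := 2 ^ (c ^ ((n - 1) * m)) with hB
  refine ⟨(2 * c * C₂ + 1) ^ (n * (n - 1)) * B, by positivity, fun k hk => ?_⟩
  choose z hz1 hz2 using hdata k hk
  let Fm : {M : Subgroup H | ∃ N : Subgroup H, N.Normal ∧
      N.FiniteIndex ∧ quotDiam S N ≤ k ∧ M = N ⊓ A} →
      (Fin (n - 1) → Fin n → Finset.Icc (-(c * (C₂ * k) : ℕ) : ℤ) (c * (C₂ * k) : ℕ)) ×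
      Set (Fin (n - 1) × Fin m → Fin c) := fun M =>
    (z M, {y | ∃ l ∈ Lat M, c • l = ∑ p, ((y p : ℕ) : ℤ) •
      (E h ^ (p.2 : ℕ)) (castV fun j => (z M p.1 j : ℤ))})
  have hFinj : Function.Injective Fm := by
    have hle : ∀ M₁ M₂, Fm M₁ = Fm M₂ → (M₁ : Subgroup H) ≤ M₂ := by
      intro M₁ M₂ h12
      have hz12 : z M₁ = z M₂ := congrArg Prod.fst h12
      have hT := congrArg Prod.snd h12
      simp only [Fm] at hT
      have hLle : Lat M₁ ≤ Lat M₂ := by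
        refine recover c hc
          (fun p : Fin (n - 1) × Fin m => (E h ^ (p.2 : ℕ)) (castV fun j => (z M₁ p.1 j : ℤ)))
          _ _ (hz1 M₁) ?_ (hz2 M₁) ?_
        · rw [hz12]; exact hz1 M₂
        · rw [hT, hz12]
      intro x hx
      have hxA : x ∈ A := by
        obtain ⟨N, -, -, -, hM⟩ := M₁.2
        rw [hM] at hx
        exact hx.2
      obtain ⟨y, hy, hy2⟩ := hLle (show ι ⟨x, hxA⟩ ∈ Lat M₁ from ⟨⟨x, hxA⟩, hx, rfl⟩)
      rw [hinj hy2] at hy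
      exact hy
    intro M₁ M₂ h12
    exact Subtype.ext (le_antisymm (hle _ _ h12) (hle _ _ h12.symm))
  have hcard := Nat.card_le_card_of_injective Fm hFinj
  have hcard2 : Nat.card ((Fin (n - 1) → Fin n →
      Finset.Icc (-(c * (C₂ * k) : ℕ) : ℤ) (c * (C₂ * k) : ℕ)) ×
      Set (Fin (n - 1) × Fin m → Fin c)) = (2 * (c * (C₂ * k)) + 1) ^ (n * (n - 1)) * B := by
    rw [Nat.card_prod, Nat.card_eq_fintype_card, Nat.card_eq_fintype_card, Fintype.card_set, hB]
    simp only [Fintype.card_pi, Fintype.card_coe, Int.card_Icc, Finset.prod_const,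
      Finset.card_univ, Fintype.card_fin, Fintype.card_prod]
    rw [← pow_mul]
    congr 2
    omega
  rw [hcard2] at hcard
  have hkR : (1 : ℝ) ≤ k := by exact_mod_cast hk
  have h1 : (({M : Subgroup H | ∃ N : Subgroup H, N.Normal ∧ N.FiniteIndex ∧
          quotDiam S N ≤ k ∧ M = N ⊓ A}.ncard : ℕ) : ℝ) ≤
      ((2 * (c * (C₂ * k)) + 1) ^ (n * (n - 1)) * B : ℕ) := by
    exact_mod_cast hcard
  refine h1.trans ?_
  push_cast
  have h2 : (2 * ((c : ℝ) * (C₂ * k)) + 1) ≤ (2 * c * C₂ + 1) * k := by nlinarith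
  have h3 : n * (n - 1) ≤ n ^ 2 - 1 := by
    obtain ⟨d, rfl⟩ : ∃ d, n = d + 1 := ⟨n - 1, by omega⟩
    have : (d + 1) ^ 2 = (d + 1) * d + d + 1 := by ring
    rw [this]
    simp only [Nat.add_sub_cancel]
    omega
  calc (2 * ((c : ℝ) * (C₂ * k)) + 1) ^ (n * (n - 1)) * B
      ≤ ((2 * c * C₂ + 1) * k) ^ (n * (n - 1)) * B := by gcongr
    _ = (2 * c * C₂ + 1) ^ (n * (n - 1)) * B * (k : ℝ) ^ (n * (n - 1)) := by rw [mul_pow]; ring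
    _ ≤ _ := by gcongr

end main_aux

/-- Let `n ≥ 3`, and let `H` be a `2`-generated group with a finite-index
normal subgroup `A` isomorphic to `ℤⁿ`.  Fix a finite generating set `S` of `H`.  Then
there is a constant `C > 0` such that for every `k ≥ 1`, the number of distinct subgroups
of `A` of the form `N ∩ A`, where `N` ranges over finite-index normal subgroups of `H`
with `diam_S(H/N) ≤ k`, is at most `C · k^(n²−1)`. -/
theorem stmt9 {H : Type*} [Group H] (n : ℕ) (hn : 3 ≤ n)
    (hgen2 : ∃ a b : H, Subgroup.closure {a, b} = ⊤)
    (A : Subgroup H) (hAnorm : A.Normal) (hAfin : A.FiniteIndex)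
    (hAiso : Nonempty (A ≃* Multiplicative (Fin n → ℤ)))
    (S : Set H) (hSfin : S.Finite) (hSgen : Subgroup.closure S = ⊤) :
    ∃ C : ℝ, 0 < C ∧ ∀ k : ℕ, 1 ≤ k →
      ({M : Subgroup H | ∃ N : Subgroup H, N.Normal ∧ N.FiniteIndex ∧
          quotDiam S N ≤ k ∧ M = N ⊓ A}.ncard : ℝ) ≤ C * (k : ℝ) ^ (n ^ 2 - 1) := by
  obtain ⟨φ⟩ := hAiso
  exact main_bound n hn hgen2 A φ S hSfin hSgen
end

section
/- Let n ≥ 3, let H be a group generated by 2 elements with a normal subgroup A of finite index with A isomorphic to ℤⁿ, and fix a finite generating set S of H. Then there exists a constant C > 0 such that for every k ≥ 1, the number of finite-index normal subgroups N of H with diam_S(H/N) ≤ k is at most C·k^{n²−1}. -/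
lemma subl_step (n X : ℕ) (L : AddSubgroup (Fin (n+1) → ℤ)) (h0 : L.index ≠ 0) (hX : L.index ≤ X) :
    ∃ d : ℕ, 1 ≤ d ∧ d ≤ X ∧ ∃ L' : AddSubgroup (Fin n → ℤ), L'.index ≠ 0 ∧ L'.index ≤ X / d ∧
      ∀ g : Fin n → (Fin n → ℤ), AddSubgroup.closure (Set.range g) = L' →
        ∃ r : Fin n → ℕ, (∀ i, r i < d) ∧
          AddSubgroup.closure (Set.range (Fin.cons (Fin.cons (d:ℤ) 0 : Fin (n+1) → ℤ)
            (fun i => (Fin.cons (r i : ℤ) (g i) : Fin (n+1) → ℤ)) : Fin (n+1) → Fin (n+1) → ℤ)) = L := by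
  let π : (Fin (n+1) → ℤ) →+ (Fin n → ℤ) :=
    { toFun := fun v => Fin.tail v, map_zero' := rfl, map_add' := fun _ _ => rfl }
  let s : ℤ →+ (Fin (n+1) → ℤ) :=
    { toFun := fun t => Fin.cons t 0
      map_zero' := by ext i; refine Fin.cases ?_ (fun i => ?_) i <;> simp
      map_add' := fun a b => by ext i; refine Fin.cases ?_ (fun i => ?_) i <;> simp }
  have hπa : ∀ v i, π v i = v i.succ := fun _ _ => rfl
  have hπ : Function.Surjective π := fun v => ⟨Fin.cons 0 v, by ext i; simp [hπa]⟩
  have hker : π.ker = s.range := by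
    ext v
    simp only [AddMonoidHom.mem_ker, AddMonoidHom.mem_range]
    constructor
    · intro h
      refine ⟨v 0, ?_⟩
      ext i
      refine Fin.cases ?_ (fun i => ?_) i
      · simp [s]
      · have := congrFun h i
        simp only [hπa] at this
        simp [s, this]
    · rintro ⟨t, rfl⟩
      ext i
      simp [hπa, s]
  have e1 : (L.map π).index = (L ⊔ π.ker).index := by
    rw [AddSubgroup.index_map, AddMonoidHom.range_eq_top.2 hπ, AddSubgroup.index_top, mul_one]
  have e2 : (L.comap s).index = L.relIndex (L ⊔ π.ker) := by
    rw [AddSubgroup.index_comap, ← hker, AddSubgroup.relIndex_sup_left]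
  have e3 : (L.comap s).index * (L.map π).index = L.index := by
    rw [e1, e2, AddSubgroup.relIndex_mul_index le_sup_left]
  obtain ⟨c, hc⟩ : ∃ c : ℤ, L.comap s = AddSubgroup.zmultiples c := by
    obtain ⟨c, hc⟩ := Int.subgroup_cyclic (L.comap s)
    exact ⟨c, by rw [hc, AddSubgroup.zmultiples_eq_closure]⟩
  set d := c.natAbs with hd
  have hdc : (L.comap s).index = d := by rw [hc, Int.index_zmultiples]
  have hmem : ∀ t : ℤ, s t ∈ L ↔ (d:ℤ) ∣ t := by
    intro t
    rw [← AddSubgroup.mem_comap, hc, Int.mem_zmultiples_iff, hd, Int.natAbs_dvd]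
  rw [hdc] at e3
  have hd0 : d ≠ 0 := by rintro h; rw [h] at e3; simp at e3; exact h0 e3.symm
  have hL0 : (L.map π).index ≠ 0 := by rintro h; rw [h] at e3; simp at e3; exact h0 e3.symm
  refine ⟨d, Nat.pos_of_ne_zero hd0, ?_, L.map π, hL0, ?_, ?_⟩
  · calc d ≤ d * (L.map π).index := Nat.le_mul_of_pos_right _ (Nat.pos_of_ne_zero hL0)
      _ ≤ X := by omega
  · rw [Nat.le_div_iff_mul_le (Nat.pos_of_ne_zero hd0)]; rw [mul_comm]; omega
  intro g hg
  have hdpos : (0:ℤ) < d := by exact_mod_cast Nat.pos_of_ne_zero hd0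
  have hx : ∀ i, ∃ r : ℕ, r < d ∧ (Fin.cons (r:ℤ) (g i) : Fin (n+1) → ℤ) ∈ L := by
    intro i
    have : g i ∈ L.map π := by rw [← hg]; exact AddSubgroup.subset_closure ⟨i, rfl⟩
    obtain ⟨x, hxL, hxg⟩ := this
    refine ⟨(x 0 % d).toNat, ?_, ?_⟩
    · have := Int.emod_lt_of_pos (x 0) hdpos
      have := Int.emod_nonneg (x 0) hdpos.ne'
      omega
    · have h1 : s (d * (x 0 / d)) ∈ L := (hmem _).2 ⟨_, rfl⟩
      have h2 := L.sub_mem hxL h1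
      convert h2 using 1
      ext j
      refine Fin.cases ?_ (fun j => ?_) j
      · have := Int.emod_nonneg (x 0) hdpos.ne'
        have h3 := Int.emod_add_mul_ediv (x 0) d
        simp only [Fin.cons_zero, Pi.sub_apply, s, AddMonoidHom.coe_mk, ZeroHom.coe_mk]
        rw [Int.toNat_of_nonneg this]; linarith
      · have := congrFun hxg j
        simp only [hπa] at this
        simp [s, this]
  choose r hr hrL using hx
  refine ⟨r, hr, ?_⟩
  set P := AddSubgroup.closure (Set.range (Fin.cons (Fin.cons (d:ℤ) 0 : Fin (n+1) → ℤ)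
            (fun i => (Fin.cons (r i : ℤ) (g i) : Fin (n+1) → ℤ)) : Fin (n+1) → Fin (n+1) → ℤ)) with hP
  have hsd : s d ∈ P := AddSubgroup.subset_closure ⟨0, by simp [s]⟩
  apply le_antisymm
  · rw [hP, AddSubgroup.closure_le]
    rintro _ ⟨i, rfl⟩
    refine Fin.cases ?_ (fun i => ?_) i
    · exact (hmem d).2 dvd_rfl
    · simpa using hrL i
  · intro v hv
    have h1 : L.map π ≤ P.map π := by
      rw [← hg, AddSubgroup.closure_le]
      rintro _ ⟨i, rfl⟩
      exact ⟨_, AddSubgroup.subset_closure ⟨i.succ, rfl⟩, by ext j; simp [hπa]⟩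
    have hPL : P ≤ L := by
      rw [hP, AddSubgroup.closure_le]
      rintro _ ⟨i, rfl⟩
      refine Fin.cases ?_ (fun i => ?_) i
      · exact (hmem d).2 dvd_rfl
      · simpa using hrL i
    obtain ⟨p, hp, hpv⟩ := h1 ⟨v, hv, rfl⟩
    have hk : v - p ∈ π.ker := by rw [AddMonoidHom.mem_ker, map_sub, hpv, sub_self]
    rw [hker] at hk
    obtain ⟨t, ht⟩ := hk
    have : s t ∈ L := by rw [ht]; exact L.sub_mem hv (hPL hp)
    obtain ⟨q, rfl⟩ := (hmem t).1 this
    have h5 : s (d * q) ∈ P := by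
      rw [mul_comm, ← smul_eq_mul, map_zsmul]; exact P.zsmul_mem hsd q
    have : v = s (d*q) + p := by rw [ht]; abel
    rw [this]; exact P.add_mem h5 hp

open Classical in
lemma subl_tuples (n : ℕ) : ∀ X : ℕ, ∃ F : Finset (Fin n → (Fin n → ℤ)), F.card ≤ X ^ n ∧
    ∀ L : AddSubgroup (Fin n → ℤ), L.index ≠ 0 → L.index ≤ X →
      ∃ g ∈ F, AddSubgroup.closure (Set.range g) = L := by
  induction n with
  | zero =>
    intro X
    refine ⟨{0}, by simp, fun L _ _ => ⟨0, by simp, Subsingleton.elim _ _⟩⟩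
  | succ n ih =>
    intro X
    choose F hF1 hF2 using ih
    let mk : ℕ → (Fin n → (Fin n → ℤ)) × (Fin n → ℕ) → (Fin (n+1) → Fin (n+1) → ℤ) := fun d p =>
      Fin.cons (Fin.cons (d:ℤ) 0 : Fin (n+1) → ℤ)
            (fun i => (Fin.cons (p.2 i : ℤ) (p.1 i) : Fin (n+1) → ℤ))
    refine ⟨(Finset.Icc 1 X).biUnion fun d =>
      ((F (X / d)) ×ˢ (Fintype.piFinset fun _ : Fin n => Finset.range d)).image (mk d), ?_, ?_⟩
    · refine (Finset.card_biUnion_le_card_mul _ _ (X ^ n) ?_).trans ?_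
      · intro d hd
        refine Finset.card_image_le.trans ?_
        rw [Finset.card_product, Fintype.card_piFinset]
        simp only [Finset.card_range, Finset.prod_const, Finset.card_univ, Fintype.card_fin]
        calc _ ≤ (X/d)^n * d^n := Nat.mul_le_mul_right _ (hF1 _)
          _ = ((X/d)*d)^n := (mul_pow _ _ _).symm
          _ ≤ _ := Nat.pow_le_pow_left (Nat.div_mul_le_self X d) n
      · simp [pow_succ, mul_comm]
    · intro L h0 hX
      obtain ⟨d, hd1, hdX, L', h1, h2, h3⟩ := subl_step n X L h0 hX
      obtain ⟨g, hg, hgL⟩ := hF2 (X/d) L' h1 h2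
      obtain ⟨r, hr, hrL⟩ := h3 g hgL
      refine ⟨mk d (g, r), ?_, hrL⟩
      simp only [Finset.mem_biUnion, Finset.mem_Icc, Finset.mem_image]
      exact ⟨d, ⟨hd1, hdX⟩, (g, r), by simp [hg, hr], rfl⟩

open Classical in
lemma subl_count (n X : ℕ) : ∃ F : Finset (AddSubgroup (Fin n → ℤ)), F.card ≤ X ^ n ∧
    ∀ L : AddSubgroup (Fin n → ℤ), L.index ≠ 0 → L.index ≤ X → L ∈ F := by
  obtain ⟨F, h1, h2⟩ := subl_tuples n X
  refine ⟨F.image fun g => AddSubgroup.closure (Set.range g), Finset.card_image_le.trans h1, ?_⟩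
  intro L h0 hX
  obtain ⟨g, hg, hgL⟩ := h2 L h0 hX
  exact Finset.mem_image.2 ⟨g, hg, hgL⟩

lemma exists_dual (Q : Type*) [CommGroup Q] [Finite Q] :
    ∃ D : Subgroup Q → Subgroup Q, Function.Injective D ∧
      ∀ K, (D K).index = Nat.card K := by
  have : NeZero (Monoid.exponent Q) := ⟨Monoid.exponent_ne_zero_of_finite⟩
  let o := CommGroup.subgroupOrderIsoSubgroupMonoidHom Q ℂ
  obtain ⟨e⟩ := CommGroup.monoidHom_mulEquiv_of_hasEnoughRootsOfUnity Q ℂ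
  refine ⟨fun K => (o K).ofDual.map e.toMonoidHom, ?_, ?_⟩
  · intro K K' h
    have := Subgroup.map_injective (f := e.toMonoidHom) e.injective h
    exact o.injective (OrderDual.ofDual.injective this)
  · intro K
    have h1 : ((o K).ofDual.map e.toMonoidHom).index = (o K).ofDual.index := by
      exact Subgroup.index_map_equiv _ e
    have h2 := CommGroup.card_subgroupOrderIsoSubgroupMonoidHom ℂ K
    have h3 := (o K).ofDual.card_mul_index
    have h4 : Nat.card (Q →* ℂˣ) = Nat.card Q := Nat.card_congr e.toEquiv
    have h5 := K.card_mul_index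
    rw [h1]
    change Nat.card (o K).ofDual = K.index at h2
    rw [h2, h4, ← h5, mul_comm] at h3
    have : Finite (Q →* ℂˣ) := Finite.of_equiv _ e.symm.toEquiv
    have h6 : K.index ≠ 0 := Subgroup.index_ne_zero_of_finite
    exact Nat.eq_of_mul_eq_mul_right (Nat.pos_of_ne_zero h6) h3

open Classical in
lemma supl_count (n J : ℕ) (M : AddSubgroup (Fin n → ℤ)) (hM : M.index ≠ 0) :
    ∃ F : Finset (AddSubgroup (Fin n → ℤ)), F.card ≤ J ^ n ∧
    ∀ L : AddSubgroup (Fin n → ℤ), M ≤ L → M.relIndex L ≤ J → L ∈ F := by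
  have : M.FiniteIndex := ⟨hM⟩
  have : Finite ((Fin n → ℤ) ⧸ M) := inferInstance
  let Q := Multiplicative ((Fin n → ℤ) ⧸ M)
  have : Finite Q := this
  obtain ⟨D, hD, hDi⟩ := exists_dual Q
  let π : (Fin n → ℤ) →+ (Fin n → ℤ) ⧸ M := QuotientAddGroup.mk' M
  have hπ : Function.Surjective π := QuotientAddGroup.mk'_surjective M
  let Φ : AddSubgroup (Fin n → ℤ) → AddSubgroup (Fin n → ℤ) := fun L =>
    (AddSubgroup.toSubgroup.symm (D (AddSubgroup.toSubgroup (L.map π)))).comap π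
  obtain ⟨F, hF1, hF2⟩ := subl_count n J
  have hinj : Set.InjOn Φ {L | M ≤ L} := by
    intro L hL L' hL' h
    have h1 := AddSubgroup.comap_injective hπ h
    have h2 := hD (AddSubgroup.toSubgroup.symm.injective h1)
    have h3 := AddSubgroup.toSubgroup.injective h2
    have h4 := congrArg (AddSubgroup.comap π) h3
    rw [AddSubgroup.comap_map_eq, AddSubgroup.comap_map_eq] at h4
    simp only [π, QuotientAddGroup.ker_mk'] at h4
    rwa [sup_eq_left.2 hL, sup_eq_left.2 hL'] at h4
  have hidx : ∀ L, (Φ L).index = M.relIndex L := by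
    intro L
    have h1 : (Φ L).index = (D (AddSubgroup.toSubgroup (L.map π))).index := by
      exact AddSubgroup.index_comap_of_surjective _ hπ
    rw [h1, hDi]
    have := AddSubgroup.relIndex_ker (K := L) π
    simp only [π, QuotientAddGroup.ker_mk'] at this
    rw [this]; rfl
  have hfin : {L | M ≤ L ∧ Φ L ∈ F}.Finite := by
    refine Set.Finite.of_finite_image (f := Φ) (F.finite_toSet.subset ?_) (hinj.mono fun L hL => hL.1)
    rintro _ ⟨L, hL, rfl⟩; exact hL.2
  refine ⟨hfin.toFinset, ?_, ?_⟩
  · refine le_trans (Finset.card_le_card_of_injOn Φ ?_ ?_) hF1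
    · intro L hL; simp at hL; exact hL.2
    · intro L hL L' hL' h
      simp at hL hL'
      exact hinj hL.1 hL'.1 h
  · intro L hML hJ
    simp only [Set.Finite.mem_toFinset, Set.mem_ofPred_eq]
    refine ⟨hML, hF2 _ ?_ ?_⟩
    · rw [hidx]
      intro h0
      have := AddSubgroup.relIndex_mul_index hML
      rw [h0, zero_mul] at this; exact hM this.symm
    · rw [hidx]; exact hJ

lemma index_rows {n : ℕ} (B : Matrix (Fin n) (Fin n) ℤ) (hB : B.det ≠ 0) :
    (AddSubgroup.closure (Set.range fun i => B i)).index = B.det.natAbs := by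
  have hli : LinearIndependent ℤ (fun i => B i) := Matrix.linearIndependent_rows_of_det_ne_zero hB
  have h := Submodule.natAbs_det_basis_change (Pi.basisFun ℤ (Fin n))
    (Submodule.span ℤ (Set.range fun i => B i)) (Module.Basis.span hli)
  have h2 : ((↑) ∘ (Module.Basis.span hli) : Fin n → (Fin n → ℤ)) = fun i => B i := by
    ext i j; simp [Module.Basis.span_apply]
  rw [h2, Pi.basisFun_det_apply] at h
  rw [← Submodule.span_int_eq_addSubgroupClosure]
  exact h.symm

lemma T_bound {n : ℕ} (T : (Fin n → ℤ) →+ (Fin n → ℤ)) : ∃ t : ℕ, ∀ (v : Fin n → ℤ) (b : ℤ),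
    (∀ x, |v x| ≤ b) → ∀ x, |T v x| ≤ t * b := by
  refine ⟨(∑ x, ∑ y, |T (Pi.single y 1) x|).toNat, fun v b hv x => ?_⟩
  have hnn : 0 ≤ ∑ x, ∑ y, |T (Pi.single y 1) x| :=
    Finset.sum_nonneg fun _ _ => Finset.sum_nonneg fun _ _ => abs_nonneg _
  rw [Int.toNat_of_nonneg hnn]
  have hb : 0 ≤ b := (abs_nonneg _).trans (hv x)
  have hv' : v = ∑ y, v y • (Pi.single y 1 : Fin n → ℤ) := by
    ext z; simp [Finset.sum_apply, Pi.single_apply]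
  have h1 : T v x = ∑ y, v y * T (Pi.single y 1) x := by
    conv_lhs => rw [hv']
    rw [map_sum, Finset.sum_apply]
    refine Finset.sum_congr rfl fun y _ => ?_
    rw [map_zsmul]; simp
  rw [h1]
  calc |∑ y, v y * T (Pi.single y 1) x| ≤ ∑ y, |v y * T (Pi.single y 1) x| :=
        Finset.abs_sum_le_sum_abs _ _
    _ ≤ ∑ y, |T (Pi.single y 1) x| * b := by
        refine Finset.sum_le_sum fun y _ => ?_
        rw [abs_mul, mul_comm]
        exact mul_le_mul_of_nonneg_left (hv y) (abs_nonneg _)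
    _ = (∑ y, |T (Pi.single y 1) x|) * b := by rw [Finset.sum_mul]
    _ ≤ _ := by
        refine mul_le_mul_of_nonneg_right ?_ hb
        exact Finset.single_le_sum (f := fun x => ∑ y, |T (Pi.single y 1) x|)
          (fun _ _ => Finset.sum_nonneg fun _ _ => abs_nonneg _) (Finset.mem_univ x)

lemma det_pert {n : ℕ} (W : Matrix (Fin n) (Fin n) ℤ) (hW : W.det ≠ 0) (r c : ℕ) (hr : 1 ≤ r) :
    ∃ R : ℕ, ∀ k : ℕ, 1 ≤ k → ∀ F : Matrix (Fin n) (Fin n) ℤ, (∀ i j, |F i j| ≤ c * k) →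
      (((r * R * k : ℕ) : ℤ) • W + F).det ≠ 0 := by
  let g : (Fin n → Fin n → ℝ) → ℝ := fun E => (Matrix.of fun i j => (W i j : ℝ) + E i j).det
  have hg : Continuous g := by
    apply Continuous.matrix_det
    apply continuous_matrix
    intro i j
    simp only [Matrix.of_apply]
    fun_prop
  have hg0 : g 0 ≠ 0 := by
    have : g 0 = ((W.det : ℤ) : ℝ) := by
      rw [Int.cast_det]
      simp only [g]
      congr 1
      ext i j; simp
    rw [this]; exact_mod_cast hW
  have hev : ∀ᶠ E in nhds (0 : Fin n → Fin n → ℝ), g E ≠ 0 := hg.continuousAt.eventually_ne hg0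
  obtain ⟨δ, hδ, hball⟩ := Metric.eventually_nhds_iff.1 hev
  obtain ⟨R, hR⟩ := exists_nat_gt ((c : ℝ) / δ)
  refine ⟨R + 1, fun k hk F hF => ?_⟩
  set s : ℝ := (r * (R+1) * k : ℝ) with hs
  have hr' : (1:ℝ) ≤ r := by exact_mod_cast hr
  have hk' : (1:ℝ) ≤ k := by exact_mod_cast hk
  have hspos : 0 < s := by positivity
  have h1 : g (fun i j => (F i j : ℝ) / s) ≠ 0 := by
    apply hball
    rw [dist_zero_right, pi_norm_lt_iff hδ]
    intro i
    rw [pi_norm_lt_iff hδ]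
    intro j
    rw [Real.norm_eq_abs, abs_div, abs_of_pos hspos, div_lt_iff₀ hspos]
    have h2 : |(F i j : ℝ)| ≤ c * k := by exact_mod_cast hF i j
    have h3 : (c : ℝ) < R * δ := by rwa [div_lt_iff₀ hδ] at hR
    have h4 : δ * ((R+1) * k) ≤ δ * s := by
      refine mul_le_mul_of_nonneg_left ?_ hδ.le
      rw [hs]
      have : 0 ≤ (R+1 : ℝ) * k := by positivity
      nlinarith
    have h5 : (c:ℝ) * k < (R * δ) * k := by
      apply mul_lt_mul_of_pos_right h3; linarith
    nlinarith
  intro h0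
  apply h1
  have h6 : (Matrix.of fun i j => (W i j : ℝ) + (F i j : ℝ) / s) =
      s⁻¹ • ((((r * (R+1) * k : ℕ) : ℤ) • W + F).map (Int.castRingHom ℝ)) := by
    ext i j
    simp only [Matrix.of_apply, Matrix.smul_apply, Matrix.map_apply, Matrix.add_apply, smul_eq_mul]
    push_cast
    simp only [eq_intCast, Int.cast_add, Int.cast_mul, Int.cast_natCast, Int.cast_one]
    rw [← hs]
    field_simp
  change (Matrix.of fun i j => (W i j : ℝ) + (F i j : ℝ) / s).det = 0
  rw [h6, Matrix.det_smul]
  have h7 := (RingHom.map_det (Int.castRingHom ℝ) (((r * (R+1) * k : ℕ) : ℤ) • W + F))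
  rw [h0, map_zero] at h7
  have h8 : ((((r * (R+1) * k : ℕ) : ℤ) • W + F).map (Int.castRingHom ℝ)).det = 0 := h7.symm
  rw [h8, mul_zero]

open Classical in
lemma lattice_count (n : ℕ) (hn : 2 ≤ n) (T : (Fin n → ℤ) →+ (Fin n → ℤ))
    (W : Matrix (Fin n) (Fin n) ℤ) (hW : W.det ≠ 0) (i j : Fin n) (hij : i ≠ j)
    (hT : W j = T (W i)) (r c : ℕ) (hr : 1 ≤ r) :
    ∃ C : ℕ, ∀ k : ℕ, 1 ≤ k → ∃ F : Finset (AddSubgroup (Fin n → ℤ)),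
      F.card ≤ C * k ^ (n ^ 2 - 1) ∧
      ∀ L : AddSubgroup (Fin n → ℤ), L.index ≠ 0 → (∀ v ∈ L, T v ∈ L) →
        (∀ a : Fin n → ℤ, ∃ l ∈ L, ∀ x, |r * a x - l x| ≤ c * k) → L ∈ F := by
  obtain ⟨t, ht⟩ := T_bound T
  obtain ⟨R, hR⟩ := det_pert W hW r (c + t * c) hr
  obtain ⟨w, hw⟩ : ∃ w : ℕ, ∀ x y, |W x y| ≤ w := by
    refine ⟨(∑ x, ∑ y, |W x y|).toNat, fun x y => ?_⟩
    have hnn : 0 ≤ ∑ x, ∑ y, |W x y| :=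
      Finset.sum_nonneg fun _ _ => Finset.sum_nonneg fun _ _ => abs_nonneg _
    refine le_trans ?_ (Int.toNat_of_nonneg hnn).ge
    refine le_trans ?_ (Finset.single_le_sum (f := fun x => ∑ y, |W x y|)
          (fun _ _ => Finset.sum_nonneg fun _ _ => abs_nonneg _) (Finset.mem_univ x))
    exact Finset.single_le_sum (f := fun y => |W x y|)
          (fun _ _ => abs_nonneg _) (Finset.mem_univ y)
  set b : ℕ := r * R * w + (c + t * c) with hb
  set Q : ℕ := (n.factorial * b ^ n) ^ n with hQ
  have hn0 : n ≠ 0 := by omega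
  refine ⟨1 + (2 * b + 1) ^ (n * (n - 1)) * Q, fun k hk => ?_⟩
  set K := k ^ (n ^ 2 - 1) with hK
  have hKpos : 0 < K := Nat.pow_pos (by omega)
  obtain ⟨F1, hF1c, hF1⟩ := subl_count n (Nat.findGreatest (fun x => x ^ n ≤ K) K)
  have hX : (Nat.findGreatest (fun x => x ^ n ≤ K) K) ^ n ≤ K :=
    Nat.findGreatest_spec (P := fun x => x ^ n ≤ K) (Nat.zero_le K) (by simp [hn0])
  set J := Nat.findGreatest (fun x => x ^ n ≤ Q * k) (Q * k) with hJdef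
  have hJ : J ^ n ≤ Q * k :=
    Nat.findGreatest_spec (P := fun x => x ^ n ≤ Q * k) (Nat.zero_le _) (by simp [hn0])
  have hJle : ∀ x, x ^ n ≤ Q * k → x ≤ J := fun x hx =>
    Nat.le_findGreatest ((Nat.le_self_pow hn0 x).trans hx) hx
  have hsup : ∀ M : AddSubgroup (Fin n → ℤ), ∃ F : Finset (AddSubgroup (Fin n → ℤ)), F.card ≤ Q * k ∧
    (M.index ≠ 0 → ∀ L : AddSubgroup (Fin n → ℤ), M ≤ L → M.relIndex L ≤ J → L ∈ F) := by
    intro M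
    by_cases hM : M.index ≠ 0
    · obtain ⟨F, h1, h2⟩ := supl_count n J M hM
      exact ⟨F, h1.trans hJ, fun _ => h2⟩
    · exact ⟨∅, by simp, fun h => absurd h hM⟩
  choose F2 hF2c hF2 using hsup
  let mkM : (Fin n → Fin n → ℤ) → AddSubgroup (Fin n → ℤ) := fun u =>
    AddSubgroup.closure (Set.range fun l => Function.update u j (T (u i)) l)
  let box : Finset (Fin n → ℤ) := Fintype.piFinset fun _ => Finset.Icc (-((b * k : ℕ) : ℤ)) ((b * k : ℕ) : ℤ)
  have hbox : box.card = (2 * b * k + 1) ^ n := by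
    simp only [box, Fintype.card_piFinset, Int.card_Icc, Finset.prod_const, Finset.card_univ, Fintype.card_fin]
    congr 1
    have : ((b * k : ℕ) : ℤ) + 1 - -((b * k : ℕ) : ℤ) = ((2 * b * k + 1 : ℕ) : ℤ) := by
      push_cast; ring
    rw [this, Int.toNat_natCast]
  let U : Finset (Fin n → Fin n → ℤ) := Fintype.piFinset fun l => if l = j then {0} else box
  have hU : U.card = ((2 * b * k + 1) ^ n) ^ (n - 1) := by
    simp only [U, Fintype.card_piFinset]
    rw [← Finset.mul_prod_erase _ _ (Finset.mem_univ j)]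
    rw [Finset.prod_congr rfl (g := fun _ => (2 * b * k + 1) ^ n)]
    · simp [Finset.card_erase_of_mem]
    · intro l hl
      rw [if_neg (Finset.ne_of_mem_erase hl), hbox]
  refine ⟨F1 ∪ U.biUnion fun u => F2 (mkM u), ?_, ?_⟩
  · have h1 : (U.biUnion fun u => F2 (mkM u)).card ≤ U.card * (Q * k) :=
      Finset.card_biUnion_le_card_mul _ _ _ fun u _ => hF2c _
    have h2 : (2 * b * k + 1) ≤ (2 * b + 1) * k := by nlinarith
    have h3 : U.card ≤ ((2 * b + 1) * k) ^ (n * (n - 1)) := by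
      rw [hU, ← pow_mul]; exact Nat.pow_le_pow_left h2 _
    have h4 : k ^ (n * (n - 1)) * k ≤ K := by
      rw [← pow_succ]
      apply Nat.pow_le_pow_right (by omega)
      obtain ⟨m, rfl⟩ : ∃ m, n = m + 2 := ⟨n - 2, by omega⟩
      have : (m + 2) ^ 2 = (m + 2) * (m + 2 - 1) + (m + 2) := by
        have : m + 2 - 1 = m + 1 := rfl
        rw [this]; ring
      omega
    calc _ ≤ F1.card + (U.biUnion fun u => F2 (mkM u)).card := Finset.card_union_le _ _
      _ ≤ K + ((2 * b + 1) * k) ^ (n * (n - 1)) * (Q * k) := by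
          refine Nat.add_le_add (hF1c.trans hX) (h1.trans (Nat.mul_le_mul_right _ h3))
      _ = K + (2 * b + 1) ^ (n * (n - 1)) * Q * (k ^ (n * (n - 1)) * k) := by rw [mul_pow]; ring
      _ ≤ K + (2 * b + 1) ^ (n * (n - 1)) * Q * K := by gcongr
      _ = _ := by ring
  · intro L hL hTL hcov
    rw [Finset.mem_union]
    by_cases hsmall : L.index ^ n ≤ K
    · left
      exact hF1 L hL (Nat.le_findGreatest ((Nat.le_self_pow hn0 _).trans hsmall) hsmall)
    right
    push Not at hsmall
    have hv : ∀ l, ∃ v ∈ L, ∀ x, |((r * R * k : ℕ) : ℤ) * W l x - v x| ≤ c * k := by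
      intro l
      obtain ⟨v, hv, hvx⟩ := hcov (((R * k : ℕ) : ℤ) • W l)
      refine ⟨v, hv, fun x => ?_⟩
      have := hvx x
      convert this using 3
      simp only [Pi.smul_apply, smul_eq_mul]; push_cast; ring
    choose v hvL hv using hv
    let u : Fin n → Fin n → ℤ := Function.update v j 0
    have hui : u i = v i := by simp [u, hij]
    let B : Matrix (Fin n) (Fin n) ℤ := Matrix.of (Function.update u j (T (u i)))
    have hBj : ∀ x, B j x = T (v i) x := by intro x; simp [B, hui]
    have hBl : ∀ l, l ≠ j → ∀ x, B l x = v l x := by intro l hl x; simp [B, u, hl]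
    let E : Matrix (Fin n) (Fin n) ℤ := B - ((r * R * k : ℕ) : ℤ) • W
    have hEa : ∀ l x, E l x = B l x - ((r * R * k : ℕ) : ℤ) * W l x := fun _ _ => rfl
    have hE : ∀ l x, |E l x| ≤ ((c + t * c : ℕ) : ℤ) * k := by
      intro l x
      by_cases hl : l = j
      · subst hl
        have h1 : E l x = T (v i - ((r * R * k : ℕ) : ℤ) • W i) x := by
          rw [map_sub, map_zsmul, ← hT]
          rw [hEa, hBj]; rfl
        rw [h1]
        refine (ht _ (c * k) ?_ x).trans ?_
        · intro y
          have := hv i y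
          rw [abs_sub_comm] at this
          simpa using this
        · push_cast
          have : (0:ℤ) ≤ c * k := by positivity
          nlinarith
      · have h1 : E l x = v l x - ((r * R * k : ℕ) : ℤ) * W l x := by
          rw [hEa, hBl l hl]
        rw [h1, abs_sub_comm]
        refine (hv l x).trans ?_
        push_cast
        have : (0:ℤ) ≤ t * c * k := by positivity
        nlinarith
    have hBE : B = ((r * R * k : ℕ) : ℤ) • W + E := by simp [E]
    have hdet : B.det ≠ 0 := by rw [hBE]; exact hR k hk E hE
    have hBb : ∀ l x, |B l x| ≤ ((b * k : ℕ) : ℤ) := by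
      intro l x
      rw [hBE]
      simp only [Matrix.add_apply, Matrix.smul_apply, smul_eq_mul]
      refine (abs_add_le _ _).trans ?_
      rw [abs_mul, Nat.abs_cast]
      have h1 := mul_le_mul_of_nonneg_left (hw l x) (by positivity : (0:ℤ) ≤ ((r * R * k : ℕ) : ℤ))
      have h2 := hE l x
      rw [hb]
      push_cast at h1 h2 ⊢
      nlinarith
    have hMidx : (mkM u).index = B.det.natAbs := index_rows B hdet
    have hM0 : (mkM u).index ≠ 0 := by rw [hMidx]; simpa using hdet
    have hML : mkM u ≤ L := by
      rw [AddSubgroup.closure_le]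
      rintro _ ⟨l, rfl⟩
      by_cases hl : l = j
      · subst hl; simp only [Function.update_self, hui]; exact hTL _ (hvL i)
      · simp only [Function.update_of_ne hl, u]; exact hvL l
    have hMle : (mkM u).index ≤ n.factorial * (b * k) ^ n := by
      rw [hMidx]
      have := Matrix.det_le (A := B) (abv := AbsoluteValue.abs) (x := ((b * k : ℕ) : ℤ)) hBb
      simp only [AbsoluteValue.abs_apply, Fintype.card_fin, nsmul_eq_mul] at this
      zify
      exact_mod_cast this
    have hrel := AddSubgroup.relIndex_mul_index hML
    rw [Finset.mem_biUnion]
    refine ⟨u, ?_, hF2 _ hM0 L hML (hJle _ ?_)⟩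
    · simp only [U, Fintype.mem_piFinset]
      intro l
      by_cases hl : l = j
      · subst hl; simp [u]
      · rw [if_neg hl]
        simp only [box, Fintype.mem_piFinset, Finset.mem_Icc]
        intro x
        have h1 := hBb l x
        rw [hBl l hl] at h1
        have h2 : u l = v l := by simp [u, hl]
        rw [h2]
        exact abs_le.1 h1
    · set ρ := (mkM u).relIndex L
      have h1 : ρ ^ n * K ≤ (Q * k) * K := by
        calc ρ ^ n * K ≤ ρ ^ n * L.index ^ n := Nat.mul_le_mul_left _ hsmall.le
          _ = (mkM u).index ^ n := by rw [← mul_pow, hrel]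
          _ ≤ (n.factorial * (b * k) ^ n) ^ n := Nat.pow_le_pow_left hMle n
          _ = Q * k ^ (n ^ 2) := by rw [hQ, mul_pow b k n, ← mul_assoc, mul_pow _ (k ^ n), ← pow_mul k, sq]
          _ = (Q * k) * K := by
            have : n ^ 2 = (n ^ 2 - 1) + 1 := by
              have : 0 < n ^ 2 := by positivity
              omega
            rw [hK, mul_assoc, ← pow_succ', ← this]
      exact Nat.le_of_mul_le_mul_right h1 hKpos

open Multiplicative in
/-- The lattice of exponent vectors whose images lie in `N`. -/
def latOf {H : Type*} [Group H] {n : ℕ} (ι : Multiplicative (Fin n → ℤ) →* H) (N : Subgroup H) :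
    AddSubgroup (Fin n → ℤ) where
  carrier := {v | ι (ofAdd v) ∈ N}
  zero_mem' := by
    change ι 1 ∈ N
    rw [map_one]; exact N.one_mem
  add_mem' := by
    intro a b ha hb
    change ι (ofAdd a * ofAdd b) ∈ N
    rw [map_mul]; exact N.mul_mem ha hb
  neg_mem' := by
    intro a ha
    change ι (ofAdd a)⁻¹ ∈ N
    rw [map_inv]; exact N.inv_mem ha

section
variable {H : Type*} [Group H] {n : ℕ} (ι : Multiplicative (Fin n → ℤ) →* H)

open Multiplicative

lemma mem_latOf (N : Subgroup H) (v : Fin n → ℤ) : v ∈ latOf ι N ↔ ι (ofAdd v) ∈ N := Iff.rfl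

lemma latOf_index (N : Subgroup H) (hN : N.FiniteIndex) : (latOf ι N).index ≠ 0 := by
  have h1 : (N.comap ι).index ≠ 0 := by
    rw [Subgroup.index_comap]
    intro h; exact hN.index_ne_zero (Subgroup.index_eq_zero_of_relIndex_eq_zero h)
  exact h1

lemma exists_conj (A : Subgroup H) (hA : A.Normal) (hinj : Function.Injective ι)
    (hr : ι.range = A) (g : H) :
    ∃ T : (Fin n → ℤ) →+ (Fin n → ℤ), ∀ v, ι (ofAdd (T v)) = g * ι (ofAdd v) * g⁻¹ := by
  have h : ∀ v : Fin n → ℤ, ∃ u : Fin n → ℤ, ι (ofAdd u) = g * ι (ofAdd v) * g⁻¹ := by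
    intro v
    have : g * ι (ofAdd v) * g⁻¹ ∈ ι.range := by
      rw [hr]; apply hA.conj_mem; rw [← hr]; exact ⟨_, rfl⟩
    obtain ⟨u, hu⟩ := this
    exact ⟨toAdd u, hu⟩
  choose T hT using h
  refine ⟨AddMonoidHom.mk' T fun a b => ?_, hT⟩
  have : ι (ofAdd (T (a + b))) = ι (ofAdd (T a + T b)) := by
    rw [ofAdd_add, map_mul, hT, hT, hT, ofAdd_add, map_mul]; group
  exact ofAdd.injective (hinj this)

/-- (F) : some element acts non-scalarly. -/
lemma exists_nonscalar_s14 (hn : 3 ≤ n) (hgen2 : ∃ a b : H, Subgroup.closure {a, b} = ⊤)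
    (A : Subgroup H) (hA : A.Normal) (hAfin : A.FiniteIndex) (hinj : Function.Injective ι)
    (hr : ι.range = A) (T : H → ((Fin n → ℤ) →+ (Fin n → ℤ)))
    (hT : ∀ g v, ι (ofAdd (T g v)) = g * ι (ofAdd v) * g⁻¹)
    (hsc : ∀ g, ∃ c : ℤ, ∀ v, T g v = c • v) : False := by
  have : Finite (H ⧸ A) := inferInstance
  have := Fintype.ofFinite (H ⧸ A)
  have hc : ∀ (h : H) (q : H ⧸ A), ∃ u : Fin n → ℤ, ι (ofAdd u) = h * q.out * (h • q).out⁻¹ := by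
    intro h q
    have h1 : h * q.out * (h • q).out⁻¹ ∈ ι.range := by
      rw [hr]
      have h2 : ((h • q).out : H ⧸ A) = ((h * q.out : H) : H ⧸ A) := by
        rw [QuotientGroup.out_eq']
        conv_lhs => rw [← QuotientGroup.out_eq' q]
        rfl
      rw [QuotientGroup.eq] at h2
      have h3 := hA.conj_mem _ h2 (h • q).out
      convert h3 using 1; group
    obtain ⟨u, hu⟩ := h1
    exact ⟨toAdd u, hu⟩
  choose c hc using hc
  let f : H → (Fin n → ℤ) := fun h => ∑ q, c h q
  have hcoc : ∀ g h q, c (g * h) q = T g (c h q) + c g (h • q) := by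
    intro g h q
    apply ofAdd.injective (hinj _)
    rw [ofAdd_add, map_mul, hT, hc, hc, hc, mul_smul]; group
  have hf : ∀ g h, f (g * h) = T g (f h) + f g := by
    intro g h
    simp only [f, hcoc, Finset.sum_add_distrib, map_sum]
    congr 1
    exact Fintype.sum_equiv (MulAction.toPerm h) _ _ fun q => rfl
  have hfA : ∀ v, f (ι (ofAdd v)) = (Fintype.card (H ⧸ A)) • v := by
    intro v
    have hmem : ι (ofAdd v) ∈ A := by rw [← hr]; exact ⟨_, rfl⟩
    have : ∀ q, c (ι (ofAdd v)) q = v := by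
      intro q
      apply ofAdd.injective (hinj _)
      rw [hc]
      have : ι (ofAdd v) • q = q := by
        induction q using QuotientGroup.induction_on with
        | H z =>
          change ((ι (ofAdd v) * z : H) : H ⧸ A) = z
          rw [eq_comm, QuotientGroup.eq]
          have := hA.conj_mem _ hmem z⁻¹
          convert this using 1; group
      rw [this]; group
    simp [f, this]
  obtain ⟨a, b, hab⟩ := hgen2
  let P : Submodule ℤ (Fin n → ℤ) := Submodule.span ℤ {f a, f b}
  have hf1 : f 1 = 0 := by
    have := hf 1 1
    have h1 : ∀ v, T 1 v = v := by
      intro v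
      apply ofAdd.injective (hinj _)
      rw [hT]; group
    rw [one_mul, h1] at this
    simpa using this
  have hTP : ∀ g v, v ∈ P → T g v ∈ P := by
    intro g v hv
    obtain ⟨c, hc⟩ := hsc g
    rw [hc]; exact P.smul_mem _ hv
  have hall : ∀ h, f h ∈ P := by
    intro h
    have hh : h ∈ Subgroup.closure {a, b} := by rw [hab]; trivial
    induction hh using Subgroup.closure_induction with
    | mem x hx =>
      rcases hx with rfl | rfl
      · exact Submodule.subset_span (by simp)
      · exact Submodule.subset_span (by simp)
    | one => rw [hf1]; exact P.zero_mem
    | mul x y _ _ hx hy => rw [hf]; exact P.add_mem (hTP _ _ hy) hx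
    | inv x _ hx =>
      have := hf x⁻¹ x
      rw [inv_mul_cancel, hf1] at this
      rw [(neg_eq_of_add_eq_zero_right this.symm).symm]
      exact P.neg_mem (hTP _ _ hx)
  let r := Fintype.card (H ⧸ A)
  have hr0 : r ≠ 0 := Fintype.card_ne_zero
  let φ : (Fin n → ℤ) →ₗ[ℤ] P :=
    LinearMap.codRestrict P ((r : ℤ) • LinearMap.id) (fun v => by
      have := hall (ι (ofAdd v))
      rw [hfA] at this
      simpa using this)
  have hφ : Function.Injective φ := by
    intro v w h
    have h1 : (r : ℤ) • v = (r : ℤ) • w := congrArg Subtype.val h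
    exact smul_right_injective _ (by exact_mod_cast hr0 : (r:ℤ) ≠ 0) h1
  have h1 := LinearMap.finrank_le_finrank_of_injective hφ
  have h2 : Module.finrank ℤ P ≤ 2 := by
    classical
    have := finrank_span_finset_le_card (R := ℤ) ({f a, f b} : Finset (Fin n → ℤ))
    have h3 := Finset.card_le_two (a := f a) (b := f b)
    simp only [Finset.coe_insert, Finset.coe_singleton] at this
    exact this.trans h3
  rw [Module.finrank_fin_fun] at h1
  omega

lemma exists_W (T : (Fin n → ℤ) →+ (Fin n → ℤ)) (hn : 0 < n)
    (hT : ¬ ∃ c : ℤ, ∀ v, T v = c • v) :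
    ∃ (W : Matrix (Fin n) (Fin n) ℤ) (i j : Fin n), W.det ≠ 0 ∧ i ≠ j ∧ W j = T (W i) := by
  -- it suffices to find a vector `w`
  have key : ∀ (w : Fin n → ℤ) (i j : Fin n), i ≠ j → (∀ l, l ≠ i → l ≠ j → w l = 0) →
      w i * T w j - w j * T w i ≠ 0 →
      ∃ (W : Matrix (Fin n) (Fin n) ℤ) (i j : Fin n), W.det ≠ 0 ∧ i ≠ j ∧ W j = T (W i) := by
    intro w i j hij hw hd
    let W : Matrix (Fin n) (Fin n) ℤ :=
      Matrix.of (Function.update (Function.update (fun l => Pi.single l 1) i w) j (T w))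
    have hWj : W j = T w := by
      change Function.update (Function.update (fun l => (Pi.single l 1 : Fin n → ℤ)) i w) j (T w) j = _
      simp
    have hWi : W i = w := by
      change Function.update (Function.update (fun l => (Pi.single l 1 : Fin n → ℤ)) i w) j (T w) i = _
      simp [hij]
    refine ⟨W, i, j, ?_, hij, by rw [hWj, hWi]⟩
    intro h0
    obtain ⟨v, hv0, hv⟩ := Matrix.exists_mulVec_eq_zero_iff.2 h0
    have hvl : ∀ l, l ≠ i → l ≠ j → v l = 0 := by
      intro l hli hlj
      have h1 := congrFun hv l
      have h2 : W l = Pi.single l 1 := by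
        change Function.update (Function.update (fun l => (Pi.single l 1 : Fin n → ℤ)) i w) j (T w) l = _
        simp [hli, hlj]
      simpa [Matrix.mulVec, h2] using h1
    have hdot : ∀ u : Fin n → ℤ, u ⬝ᵥ v = u i * v i + u j * v j := by
      intro u
      rw [dotProduct, ← Finset.add_sum_erase _ _ (Finset.mem_univ i),
        ← Finset.add_sum_erase _ _ (Finset.mem_erase.2 ⟨hij.symm, Finset.mem_univ j⟩),
        Finset.sum_eq_zero, add_zero]
      intro l hl
      simp only [Finset.mem_erase] at hl
      rw [hvl l hl.2.1 hl.1, mul_zero]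
    have e1 : w i * v i + w j * v j = 0 := by
      rw [← hdot, ← hWi]; exact congrFun hv i
    have e2 : T w i * v i + T w j * v j = 0 := by
      rw [← hdot, ← hWj]; exact congrFun hv j
    have e3 : (w i * T w j - w j * T w i) * v i = 0 := by linear_combination T w j * e1 - w j * e2
    have e4 : (w i * T w j - w j * T w i) * v j = 0 := by linear_combination w i * e2 - T w i * e1
    have f1 := (mul_eq_zero.1 e3).resolve_left hd
    have f2 := (mul_eq_zero.1 e4).resolve_left hd
    apply hv0
    ext l
    by_cases h1 : l = i
    · rw [h1, f1]; rfl
    by_cases h2 : l = j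
    · rw [h2, f2]; rfl
    exact hvl l h1 h2
  by_contra hcon
  have hoff : ∀ i j, i ≠ j → T (Pi.single i 1) j = 0 := by
    intro i j hij
    by_contra h
    apply hcon
    refine key (Pi.single i 1) i j hij ?_ ?_
    · intro l h1 _; simp [h1]
    · simpa [hij.symm] using h
  have hdiag : ∀ i j, T (Pi.single i 1) i = T (Pi.single j 1) j := by
    intro i j
    by_contra h
    have hij : i ≠ j := by rintro rfl; exact h rfl
    apply hcon
    refine key (Pi.single i 1 + Pi.single j 1) i j hij ?_ ?_
    · intro l h1 h2; simp [h1, h2]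
    · rw [map_add]
      simp only [Pi.add_apply, Pi.single_eq_same, hoff i j hij, hoff j i hij.symm,
        Pi.single_eq_of_ne hij, Pi.single_eq_of_ne hij.symm]
      intro h2; apply h; linarith
  apply hT
  refine ⟨T (Pi.single ⟨0, hn⟩ 1) ⟨0, hn⟩, fun v => ?_⟩
  have hv' : v = ∑ y, v y • (Pi.single y 1 : Fin n → ℤ) := by
    ext z; simp [Finset.sum_apply, Pi.single_apply]
  ext x
  have h1 : T v x = ∑ y, v y * T (Pi.single y 1) x := by
    conv_lhs => rw [hv']
    rw [map_sum, Finset.sum_apply]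
    refine Finset.sum_congr rfl fun y _ => ?_
    rw [map_zsmul]; simp
  rw [h1, Finset.sum_eq_single x]
  · rw [hdiag x ⟨0, hn⟩]; simp [mul_comm]
  · intro y _ hy; rw [hoff y x hy, mul_zero]
  · simp
end

section
variable {H : Type*} [Group H]

lemma wordLength_spec (S : Set H) (hSgen : Subgroup.closure S = ⊤) (h : H) :
    ∃ w : List H, (∀ g ∈ w, g ∈ S ∪ S⁻¹) ∧ w.prod = h ∧ w.length = wordLength S h := by
  have hne : {ℓ : ℕ | ∃ w : List H, (∀ g ∈ w, g ∈ S ∪ S⁻¹) ∧ w.prod = h ∧ w.length = ℓ}.Nonempty := by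
    have hh : h ∈ Subgroup.closure S := by rw [hSgen]; trivial
    rw [← Subgroup.mem_toSubmonoid, Subgroup.closure_toSubmonoid] at hh
    obtain ⟨w, hw, hp⟩ := Submonoid.exists_list_of_mem_closure hh
    exact ⟨w.length, w, hw, hp, rfl⟩
  exact Nat.sInf_mem hne

lemma quotDiam_spec (S : Set H) (N : Subgroup H) (hN : N.FiniteIndex) (k : ℕ)
    (hk : quotDiam S N ≤ k) (h : H) : ∃ m ∈ N, wordLength S (h * m) ≤ k := by
  let f : H → ℕ := fun h => sInf {ℓ : ℕ | ∃ n ∈ N, wordLength S (h * n) = ℓ}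
  have hf : ∀ h h' : H, h⁻¹ * h' ∈ N → f h = f h' := by
    intro h h' hh
    simp only [f]
    congr 1
    ext ℓ
    constructor
    · rintro ⟨m, hm, e⟩
      refine ⟨h'⁻¹ * h * m, N.mul_mem ?_ hm, ?_⟩
      · have := N.inv_mem hh
        simpa using this
      · rw [← e]; congr 1; group
    · rintro ⟨m, hm, e⟩
      refine ⟨h⁻¹ * h' * m, N.mul_mem hh hm, ?_⟩
      rw [← e]; congr 1; group
  have hfin : (Set.range f).Finite := by
    have : Finite (H ⧸ N) := inferInstance
    refine (Set.finite_range (fun q : H ⧸ N => f q.out)).subset ?_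
    rintro _ ⟨h, rfl⟩
    refine ⟨(h : H ⧸ N), ?_⟩
    apply hf
    rw [← QuotientGroup.eq]
    exact QuotientGroup.out_eq' _
  have h1 : f h ≤ k := (le_csSup hfin.bddAbove ⟨h, rfl⟩).trans hk
  have hne : {ℓ : ℕ | ∃ n ∈ N, wordLength S (h * n) = ℓ}.Nonempty := ⟨_, 1, N.one_mem, rfl⟩
  obtain ⟨m, hm, e⟩ := Nat.sInf_mem hne
  exact ⟨m, hm, e.le.trans h1⟩

variable {n : ℕ} (ι : Multiplicative (Fin n → ℤ) →* H)
open Multiplicative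

lemma exists_abs_bound {α : Type*} (F : Set α) (hF : F.Finite) (v : α → Fin n → ℤ) :
    ∃ c : ℕ, ∀ p ∈ F, ∀ x, |v p x| ≤ c := by
  refine ⟨∑ p ∈ hF.toFinset, ∑ x, (v p x).natAbs, fun p hp x => ?_⟩
  have h1 : (v p x).natAbs ≤ ∑ x, (v p x).natAbs :=
    Finset.single_le_sum (f := fun x => (v p x).natAbs) (fun _ _ => Nat.zero_le _) (Finset.mem_univ x)
  have h2 : ∑ x, (v p x).natAbs ≤ ∑ p ∈ hF.toFinset, ∑ x, (v p x).natAbs :=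
    Finset.single_le_sum (f := fun p => ∑ x, (v p x).natAbs) (fun _ _ => Nat.zero_le _)
      (hF.mem_toFinset.2 hp)
  rw [Int.abs_eq_natAbs]
  exact_mod_cast h1.trans h2

lemma word_vec (A : Subgroup H) (hAfin : A.FiniteIndex) (hr : ι.range = A)
    (S : Set H) (hS : S.Finite) :
    ∃ c : ℕ, ∀ w : List H, (∀ g ∈ w, g ∈ S ∪ S⁻¹) → ∃ u : Fin n → ℤ,
      ι (ofAdd u) = ((w.prod : H) : H ⧸ A).out⁻¹ * w.prod ∧ ∀ x, |u x| ≤ c * (w.length + 1) := by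
  have hfin : Finite (H ⧸ A) := inferInstance
  have hv : ∀ p : H × (H ⧸ A), ∃ v : Fin n → ℤ,
      ι (ofAdd v) = (p.1 • p.2).out⁻¹ * p.1 * p.2.out := by
    rintro ⟨s, q⟩
    have : (s • q).out⁻¹ * s * q.out ∈ ι.range := by
      rw [hr, mul_assoc, ← QuotientGroup.eq, QuotientGroup.out_eq']
      conv_lhs => rw [← QuotientGroup.out_eq' q]
      rfl
    obtain ⟨v, hv⟩ := this
    exact ⟨toAdd v, hv⟩
  choose v hv using hv
  obtain ⟨c0, hc0⟩ := exists_abs_bound ((S ∪ S⁻¹) ×ˢ (Set.univ : Set (H ⧸ A)))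
    ((hS.union hS.inv).prod Set.finite_univ) v
  have h1 : ∃ u0 : Fin n → ℤ, ι (ofAdd u0) = ((1 : H) : H ⧸ A).out⁻¹ * 1 := by
    have : ((1 : H) : H ⧸ A).out⁻¹ * 1 ∈ ι.range := by
      rw [hr, ← QuotientGroup.eq, QuotientGroup.out_eq']
    obtain ⟨v, hv⟩ := this
    exact ⟨toAdd v, hv⟩
  obtain ⟨u0, hu0⟩ := h1
  obtain ⟨c1, hc1⟩ := exists_abs_bound (Set.univ : Set Unit) Set.finite_univ (fun _ => u0)
  refine ⟨c0 + c1, fun w => ?_⟩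
  induction w with
  | nil =>
    intro _
    refine ⟨u0, by simpa using hu0, fun x => ?_⟩
    have := hc1 () trivial x
    simp only [List.length_nil]
    push_cast
    linarith
  | cons s w ih =>
    intro hw
    obtain ⟨u, hu, hb⟩ := ih fun g hg => hw g (by simp [hg])
    refine ⟨v (s, ((w.prod : H) : H ⧸ A)) + u, ?_, fun x => ?_⟩
    · rw [ofAdd_add, map_mul, hv, hu, List.prod_cons]
      have : s • ((w.prod : H) : H ⧸ A) = ((s * w.prod : H) : H ⧸ A) := rfl
      simp only [this]
      group
    · have h2 := hc0 (s, ((w.prod : H) : H ⧸ A)) ⟨hw s (by simp), trivial⟩ x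
      have h3 := hb x
      have h4 := abs_add_le (v (s, ((w.prod : H) : H ⧸ A)) x) (u x)
      simp only [List.length_cons, Pi.add_apply]
      push_cast at h3 ⊢
      have : (0 : ℤ) ≤ c1 := by positivity
      linarith

lemma covering (A : Subgroup H) (hA : A.Normal) (hAfin : A.FiniteIndex) (hr : ι.range = A)
    (S : Set H) (hS : S.Finite) (hSgen : Subgroup.closure S = ⊤) :
    ∃ c : ℕ, ∀ k : ℕ, 1 ≤ k → ∀ N : Subgroup H, N.Normal → N.FiniteIndex → quotDiam S N ≤ k →
      ∀ a : Fin n → ℤ, ∃ l ∈ latOf ι N, ∀ x, |(A.index : ℤ) * a x - l x| ≤ c * k := by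
  obtain ⟨c1, hc1⟩ := word_vec ι A hAfin hr S hS
  have hfin : Finite (H ⧸ A) := inferInstance
  have hz : ∀ q : H ⧸ A, ∃ z : Fin n → ℤ, ι (ofAdd z) = q.out ^ A.index := by
    intro q
    have : q.out ^ A.index ∈ ι.range := by rw [hr]; exact A.pow_index_mem _
    obtain ⟨v, hv⟩ := this
    exact ⟨toAdd v, hv⟩
  choose z hz using hz
  obtain ⟨c2, hc2⟩ := exists_abs_bound (Set.univ : Set (H ⧸ A)) Set.finite_univ z
  refine ⟨2 * A.index * c1 + c2, fun k hk N hN hNf hd a => ?_⟩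
  obtain ⟨m, hm, hml⟩ := quotDiam_spec S N hNf k hd (ι (ofAdd a))
  obtain ⟨w, hw, hwp, hwl⟩ := wordLength_spec S hSgen (ι (ofAdd a) * m)
  obtain ⟨u, hu, hub⟩ := hc1 w hw
  rw [hwp] at hu
  set q : H ⧸ A := ((ι (ofAdd a) * m : H) : H ⧸ A) with hq
  refine ⟨A.index • (a - u) - z q, ?_, fun x => ?_⟩
  · rw [mem_latOf, ← QuotientGroup.eq_one_iff (N := N)]
    have e1 : ((q.out : H) : H ⧸ N) = ((ι (ofAdd (a - u)) : H) : H ⧸ N) := by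
      have e2 : ι (ofAdd a) = q.out * ι (ofAdd u) * m⁻¹ := by rw [hu]; group
      have e3 : ι (ofAdd (a - u)) = q.out * (ι (ofAdd u) * m⁻¹ * (ι (ofAdd u))⁻¹) := by
        rw [ofAdd_sub, map_div, e2, div_eq_mul_inv]; group
      rw [QuotientGroup.eq, e3, inv_mul_cancel_left]
      exact hN.conj_mem _ (N.inv_mem hm) _
    rw [ofAdd_sub, map_div, hz, ofAdd_nsmul, map_pow, QuotientGroup.mk_div, QuotientGroup.mk_pow,
      QuotientGroup.mk_pow, e1, div_self']
  · have h1 := hub x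
    have h2 := hc2 q trivial x
    have e : (A.index : ℤ) * a x - (A.index • (a - u) - z q) x = A.index * u x + z q x := by
      rw [Pi.sub_apply, Pi.smul_apply, Pi.sub_apply, nsmul_eq_mul]; ring
    rw [e]
    have h3 := abs_add_le ((A.index : ℤ) * u x) (z q x)
    rw [abs_mul, Nat.abs_cast] at h3
    have h4 : (A.index : ℤ) * |u x| ≤ A.index * (c1 * (2 * k)) := by
      gcongr
      refine h1.trans ?_
      gcongr
      rw [hwl]
      have : (wordLength S (ι (ofAdd a) * m) : ℤ) ≤ k := by exact_mod_cast hml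
      have : (1 : ℤ) ≤ k := by exact_mod_cast hk
      linarith
    have h5 : (c2 : ℤ) ≤ c2 * k := by
      exact_mod_cast Nat.le_mul_of_pos_right c2 hk
    push_cast
    linarith
end

section
open Multiplicative

lemma torsion_card (n r : ℕ) (hr : 1 ≤ r) : ∃ R : ℕ, ∀ L : AddSubgroup (Fin n → ℤ), L.index ≠ 0 →
    Finite ((Fin n → ℤ) ⧸ L) ∧ Nat.card {x : (Fin n → ℤ) ⧸ L // r • x = 0} ≤ R := by
  have : NeZero r := ⟨by omega⟩
  let m : (Fin n → ℤ) →+ (Fin n → ℤ) := nsmulAddMonoidHom r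
  have hm : m.range.index ≠ 0 := by
    let φ : (Fin n → ℤ) →+ (Fin n → ZMod r) :=
      { toFun := fun v x => (v x : ZMod r)
        map_zero' := by ext; simp
        map_add' := by intro a b; ext; simp }
    have hle : φ.ker ≤ m.range := by
      intro v hv
      have h1 : ∀ x, (r : ℤ) ∣ v x := by
        intro x
        rw [← ZMod.intCast_zmod_eq_zero_iff_dvd]
        exact congrFun hv x
      choose w hw using h1
      refine ⟨w, ?_⟩
      ext x
      rw [hw x]
      simp [m]
    have h2 : φ.ker.index ≠ 0 := by
      rw [AddSubgroup.index_ker]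
      exact Nat.card_pos.ne'
    intro h
    exact h2 (Nat.eq_zero_of_zero_dvd (h ▸ AddSubgroup.index_dvd_of_le hle))
  refine ⟨m.range.index, fun L hL => ?_⟩
  have hfin : Finite ((Fin n → ℤ) ⧸ L) := by
    have : L.FiniteIndex := ⟨hL⟩
    infer_instance
  refine ⟨hfin, ?_⟩
  let f : ((Fin n → ℤ) ⧸ L) →+ ((Fin n → ℤ) ⧸ L) := nsmulAddMonoidHom r
  have h1 : Nat.card {x : (Fin n → ℤ) ⧸ L // r • x = 0} = Nat.card f.ker := rfl
  have h2 := f.ker.card_mul_index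
  have h3 := f.range.card_mul_index
  rw [AddSubgroup.index_ker] at h2
  have hpos : 0 < Nat.card f.range := Nat.card_pos
  have h4 : Nat.card f.ker = f.range.index := by
    apply Nat.eq_of_mul_eq_mul_left hpos
    rw [h3, ← h2, mul_comm]
  rw [h1, h4, ← AddSubgroup.index_comap_of_surjective f.range
    (QuotientAddGroup.mk'_surjective L)]
  have hle : m.range ≤ f.range.comap (QuotientAddGroup.mk' L) := by
    rintro _ ⟨v, rfl⟩
    exact ⟨(v : (Fin n → ℤ) ⧸ L), rfl⟩
  exact Nat.le_of_dvd (Nat.pos_of_ne_zero hm) (AddSubgroup.index_dvd_of_le hle)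

variable {H : Type*} [Group H] {n : ℕ} (ι : Multiplicative (Fin n → ℤ) →* H)

lemma fiber_torsion (A : Subgroup H) (hA : A.Normal) (hr : ι.range = A)
    (N N' : Subgroup H) (hN : N.Normal) (hN' : N'.Normal) (hL : latOf ι N = latOf ι N')
    (g : H) (a : Fin n → ℤ) (hg : g ∈ N') (hga : g * ι (ofAdd a) ∈ N) :
    A.index • a ∈ latOf ι N := by
  have hinA : ∀ x ∈ A, (x ∈ N ↔ x ∈ N') := by
    intro x hx
    rw [← hr] at hx
    obtain ⟨v, rfl⟩ := hx
    have := (mem_latOf ι N (toAdd v)).symm.trans ((hL ▸ Iff.rfl : _ ↔ _ ).trans (mem_latOf ι N' (toAdd v)))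
    simpa using this
  let K := N ⊓ N'
  have hK : K.Normal := inferInstance
  have hKA : ∀ x ∈ A, x ∈ N' → x ∈ K := fun x hx h => ⟨(hinA x hx).2 h, h⟩
  have hKA' : ∀ x ∈ A, x ∈ N → x ∈ K := fun x hx h => ⟨h, (hinA x hx).1 h⟩
  have haA : ι (ofAdd a) ∈ A := by rw [← hr]; exact ⟨_, rfl⟩
  have hcomm : Commute ((g : H) : H ⧸ K) ((ι (ofAdd a) : H) : H ⧸ K) := by
    change ((g * ι (ofAdd a) : H) : H ⧸ K) = ((ι (ofAdd a) * g : H) : H ⧸ K)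
    rw [QuotientGroup.eq]
    apply hKA
    · have := A.mul_mem (A.inv_mem haA) (hA.conj_mem _ haA g⁻¹)
      convert this using 1; group
    · have := N'.mul_mem (hN'.conj_mem _ (N'.inv_mem hg) (ι (ofAdd a))⁻¹) hg
      convert this using 1; group
  have h1 : (((g * ι (ofAdd a)) ^ A.index : H) : H ⧸ K) = 1 :=
    (QuotientGroup.eq_one_iff _).2 (hKA' _ (A.pow_index_mem _) (N.pow_mem hga _))
  have h2 : ((g ^ A.index : H) : H ⧸ K) = 1 :=
    (QuotientGroup.eq_one_iff _).2 (hKA _ (A.pow_index_mem _) (N'.pow_mem hg _))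
  rw [QuotientGroup.mk_pow, QuotientGroup.mk_mul, hcomm.mul_pow, ← QuotientGroup.mk_pow, h2, one_mul,
    ← QuotientGroup.mk_pow, ← map_pow, ← ofAdd_nsmul, QuotientGroup.eq_one_iff] at h1
  exact h1.1

lemma fiber_count (A : Subgroup H) (hA : A.Normal) (hAfin : A.FiniteIndex) (hr : ι.range = A) :
    ∃ D : ℕ, ∀ L : AddSubgroup (Fin n → ℤ), L.index ≠ 0 →
      {N : Subgroup H | N.Normal ∧ latOf ι N = L}.Finite ∧
      {N : Subgroup H | N.Normal ∧ latOf ι N = L}.ncard ≤ D := by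
  obtain ⟨R, hR⟩ := torsion_card n A.index (Nat.one_le_iff_ne_zero.2 hAfin.index_ne_zero)
  refine ⟨2 ^ (A.index * R), fun L hL => ?_⟩
  obtain ⟨hfin, hcard⟩ := hR L hL
  have hfinA : Finite (H ⧸ A) := inferInstance
  have hrep : ∀ q : H ⧸ A, ∃ g : H, ∀ N : Subgroup H, N.Normal → latOf ι N = L →
      ∀ h ∈ N, (h : H ⧸ A) = q → (g : H ⧸ A) = q ∧
        ∃ N' : Subgroup H, N'.Normal ∧ latOf ι N' = L ∧ g ∈ N' := by
    intro q
    by_cases hq : ∃ g : H, (g : H ⧸ A) = q ∧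
        ∃ N' : Subgroup H, N'.Normal ∧ latOf ι N' = L ∧ g ∈ N'
    · obtain ⟨g, hg⟩ := hq
      exact ⟨g, fun _ _ _ _ _ _ => hg⟩
    · exact ⟨1, fun N h1 h2 h h3 h4 => absurd ⟨h, h4, N, h1, h2, h3⟩ hq⟩
  choose g hg using hrep
  let Tor := {x : (Fin n → ℤ) ⧸ L // A.index • x = 0}
  let Φ : {N : Subgroup H | N.Normal ∧ latOf ι N = L} → Set ((H ⧸ A) × Tor) := fun N =>
    {p | ∃ a : Fin n → ℤ, (a : (Fin n → ℤ) ⧸ L) = p.2.1 ∧ g p.1 * ι (ofAdd a) ∈ N.1}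
  have hmono : ∀ N N', Φ N ⊆ Φ N' → N.1 ≤ N'.1 := by
    rintro ⟨N, hN, hNL⟩ ⟨N', hN', hNL'⟩ hΦ h hh
    obtain ⟨h1, N'', hN'', hNL'', hgN⟩ := hg (h : H ⧸ A) N hN hNL h hh rfl
    rw [QuotientGroup.eq] at h1
    obtain ⟨a, ha⟩ := hr.ge h1
    have ha' : h = g (h : H ⧸ A) * ι (ofAdd (toAdd a)) := by
      rw [ofAdd_toAdd, ha]; group
    have htor : A.index • toAdd a ∈ L := by
      have := fiber_torsion ι A hA hr N N'' hN hN'' (hNL.trans hNL''.symm) (g (h : H ⧸ A))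
        (toAdd a) hgN (ha' ▸ hh)
      rwa [hNL] at this
    have hx : A.index • ((toAdd a : Fin n → ℤ) : (Fin n → ℤ) ⧸ L) = 0 :=
      (QuotientAddGroup.eq_zero_iff _).2 htor
    have hmem : ((h : H ⧸ A), (⟨_, hx⟩ : Tor)) ∈ Φ ⟨N, hN, hNL⟩ := ⟨toAdd a, rfl, ha' ▸ hh⟩
    obtain ⟨a', e1, e2⟩ := hΦ hmem
    have e3 : -a' + toAdd a ∈ L := QuotientAddGroup.eq.1 e1
    rw [← hNL', mem_latOf] at e3
    have := N'.mul_mem e2 e3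
    rw [ofAdd_add, map_mul, ofAdd_neg, map_inv, mul_assoc, mul_inv_cancel_left, ← ha'] at this
    exact this
  have hinj : Function.Injective Φ := fun N N' h =>
    Subtype.ext (le_antisymm (hmono N N' h.le) (hmono N' N h.ge))
  have hF : Finite {N : Subgroup H | N.Normal ∧ latOf ι N = L} := Finite.of_injective Φ hinj
  refine ⟨hF, ?_⟩
  have h1 := Nat.card_le_card_of_injective Φ hinj
  have h2 : Nat.card (Set ((H ⧸ A) × Tor)) = 2 ^ (A.index * Nat.card Tor) := by
    have := Fintype.ofFinite (H ⧸ A)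
    have := Fintype.ofFinite Tor
    rw [Nat.card_eq_fintype_card, Fintype.card_set, Fintype.card_prod, ← Nat.card_eq_fintype_card,
      ← Nat.card_eq_fintype_card]
    rfl
  rw [h2] at h1
  refine h1.trans ?_
  exact Nat.pow_le_pow_right (by norm_num) (Nat.mul_le_mul_left _ hcard)
end

/-- Let `n ≥ 3`, let `H` be a `2`-generated group with a finite-index normal
subgroup `A` isomorphic to `ℤⁿ`, and fix a finite generating set `S` of `H`.  Then there
is a constant `C > 0` such that for every `k ≥ 1`, the number of finite-index normal
subgroups `N` of `H` with `diam_S(H/N) ≤ k` is at most `C · k^(n²−1)`. -/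
theorem stmt14 {H : Type*} [Group H] (n : ℕ) (hn : 3 ≤ n)
    (hgen2 : ∃ a b : H, Subgroup.closure {a, b} = ⊤)
    (A : Subgroup H) (hAnorm : A.Normal) (hAfin : A.FiniteIndex)
    (hAiso : Nonempty (A ≃* Multiplicative (Fin n → ℤ)))
    (S : Set H) (hSfin : S.Finite) (hSgen : Subgroup.closure S = ⊤) :
    ∃ C : ℝ, 0 < C ∧ ∀ k : ℕ, 1 ≤ k →
      ({N : Subgroup H | N.Normal ∧ N.FiniteIndex ∧ quotDiam S N ≤ k}.ncard : ℝ) ≤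
        C * (k : ℝ) ^ (n ^ 2 - 1) := by
  obtain ⟨e⟩ := hAiso
  let ι : Multiplicative (Fin n → ℤ) →* H := A.subtype.comp e.symm.toMonoidHom
  have hinj : Function.Injective ι := A.subtype_injective.comp e.symm.injective
  have hr : ι.range = A := by
    ext x
    constructor
    · rintro ⟨v, rfl⟩; exact (e.symm v).2
    · intro hx; exact ⟨e ⟨x, hx⟩, by simp [ι]⟩
  choose T hT using exists_conj ι A hAnorm hinj hr
  have hns : ∃ g, ¬ ∃ c : ℤ, ∀ v, T g v = c • v := by
    by_contra h
    push Not at h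
    exact exists_nonscalar_s14 ι hn hgen2 A hAnorm hAfin hinj hr T hT h
  obtain ⟨g, hg⟩ := hns
  obtain ⟨W, i, j, hW, hij, hWT⟩ := exists_W (T g) (by omega) hg
  obtain ⟨c, hc⟩ := covering ι A hAnorm hAfin hr S hSfin hSgen
  obtain ⟨C, hC⟩ := lattice_count n (by omega) (T g) W hW i j hij hWT A.index c
    (Nat.one_le_iff_ne_zero.2 hAfin.index_ne_zero)
  obtain ⟨D, hD⟩ := fiber_count ι A hAnorm hAfin hr
  refine ⟨C * D + 1, by positivity, fun k hk => ?_⟩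
  obtain ⟨F, hF, hFm⟩ := hC k hk
  classical
  let F' := F.filter fun L => L.index ≠ 0
  have hF' : ∀ L ∈ F', L.index ≠ 0 := fun L hL => (Finset.mem_filter.1 hL).2
  have hsub : {N : Subgroup H | N.Normal ∧ N.FiniteIndex ∧ quotDiam S N ≤ k} ⊆
      ⋃ L ∈ F', {N : Subgroup H | N.Normal ∧ latOf ι N = L} := by
    rintro N ⟨hN, hNf, hNd⟩
    have hi := latOf_index ι N hNf
    have hmem : latOf ι N ∈ F := by
      refine hFm _ hi ?_ (hc k hk N hN hNf hNd)
      intro v hv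
      rw [mem_latOf, hT]
      exact hN.conj_mem _ hv _
    exact Set.mem_biUnion (x := latOf ι N) (Finset.mem_filter.2 ⟨hmem, hi⟩) ⟨hN, rfl⟩
  have hfin : (⋃ L ∈ F', {N : Subgroup H | N.Normal ∧ latOf ι N = L}).Finite :=
    F'.finite_toSet.biUnion fun L hL => (hD L (hF' L hL)).1
  have h1 := Set.ncard_le_ncard hsub hfin
  have h2 : (⋃ L ∈ F', {N : Subgroup H | N.Normal ∧ latOf ι N = L}).ncard ≤
      ∑ L ∈ F', {N : Subgroup H | N.Normal ∧ latOf ι N = L}.ncard :=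
    Finset.set_ncard_biUnion_le _ _
  have h3 : ∑ L ∈ F', {N : Subgroup H | N.Normal ∧ latOf ι N = L}.ncard ≤ F'.card * D := by
    rw [← smul_eq_mul]
    exact Finset.sum_le_card_nsmul _ _ _ fun L hL => (hD L (hF' L hL)).2
  have h4 : F'.card * D ≤ (C * k ^ (n ^ 2 - 1)) * D :=
    Nat.mul_le_mul_right _ ((Finset.card_filter_le _ _).trans hF)
  have h5 : ({N : Subgroup H | N.Normal ∧ N.FiniteIndex ∧ quotDiam S N ≤ k}.ncard : ℝ) ≤
      (C * k ^ (n ^ 2 - 1)) * D := by exact_mod_cast h1.trans (h2.trans (h3.trans h4))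
  refine h5.trans ?_
  have : (0 : ℝ) ≤ (k : ℝ) ^ (n ^ 2 - 1) := by positivity
  nlinarith
end
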